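/- arXiv:2007.06738 — 8 statements merged into one kernel-verified Lean document; each statement's English description precedes it below -/
import Mathlib

section
/- For every integer D ≥ 2, every initialization scale α > 0, and every time t ≥ 0, the gradient-flow trajectory of the diagonal linear network with exponential loss satisfies L(u(t)) ≤ 1 / (1 + 2 D² α^{2D−2} γ₂² t). -/
open Real Finset Filter Topology MeasureTheory

/-- A function whose derivative is at least `c` on `[0, ∞)` grows at least linearly with slope `c`. -/
lemma add_mul_le_of_le_hasDerivAt {f f' : ℝ → ℝ} {c t : ℝ}
    (hf : ∀ s, 0 ≤ s → s ≤ t → HasDerivAt f (f' s) s) (hc : ∀ s, 0 ≤ s → s ≤ t → c ≤ f' s)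
    (ht : 0 ≤ t) : f 0 + c * t ≤ f t := by
  have h := (convex_Icc (0 : ℝ) t).mul_sub_le_image_sub_of_le_deriv (f := f) (C := c)
    (fun s hs => (hf s hs.1 hs.2).continuousAt.continuousWithinAt)
    (fun s hs => by
      rw [interior_Icc] at hs
      exact (hf s hs.1.le hs.2.le).differentiableAt.differentiableWithinAt)
    (fun s hs => by
      rw [interior_Icc] at hs
      rw [(hf s hs.1.le hs.2.le).deriv]
      exact hc s hs.1.le hs.2.le)
    0 ⟨le_rfl, ht⟩ t ⟨ht, le_rfl⟩ ht
  linarith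

/-- A function with vanishing derivative on `[0, ∞)` keeps its initial value. -/
lemma eq_zero_time_of_hasDerivAt_zero {f f' : ℝ → ℝ} {t : ℝ}
    (hf : ∀ s, 0 ≤ s → s ≤ t → HasDerivAt f (f' s) s) (hc : ∀ s, 0 ≤ s → s ≤ t → f' s = 0)
    (ht : 0 ≤ t) : f t = f 0 := by
  have h₁ := add_mul_le_of_le_hasDerivAt (c := 0) hf (fun s h h' => (hc s h h').ge) ht
  have h₂ := add_mul_le_of_le_hasDerivAt (f := fun s => -f s) (f' := fun s => -f' s) (c := 0)
    (fun s h h' => (hf s h h').neg) (fun s h h' => by simp [hc s h h']) ht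
  linarith

/-- Solutions of `u' = a u` with continuous `a` remain positive. -/
lemma pos_of_hasDerivAt_mul_self {u a : ℝ → ℝ} (ha : ContinuousOn a (Set.Ici 0))
    (hu : ∀ t, 0 ≤ t → HasDerivAt u (a t * u t) t) (h0 : 0 < u 0) {t : ℝ} (ht : 0 ≤ t) :
    0 < u t := by
  have hne : ∀ s, 0 ≤ s → u s ≠ 0 := by
    intro T hT hz
    obtain ⟨M, hM⟩ := isCompact_Icc.exists_bound_of_continuousOn
      (ha.mono (Set.Icc_subset_Ici_self : Set.Icc 0 T ⊆ Set.Ici 0))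
    have h := add_mul_le_of_le_hasDerivAt (f := fun s => u s ^ 2 * exp (2 * M * s))
      (f' := fun s => 2 * (a s + M) * (u s ^ 2 * exp (2 * M * s))) (c := 0) (t := T)
      (fun s hs _ => by
        have h₁ := ((hu s hs).pow 2).mul (((hasDerivAt_id s).const_mul (2 * M)).exp)
        refine h₁.congr_deriv ?_
        simp
        ring)
      (fun s hs hs' => by
        have := (abs_le.1 (hM s ⟨hs, hs'⟩)).1
        have : 0 ≤ a s + M := by linarith
        positivity) hT
    simp only [hz] at h
    have : 0 < u 0 ^ 2 := by positivity
    simp at h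
    linarith
  by_contra! hle
  have hc : ContinuousOn u (Set.Icc 0 t) :=
    fun s hs => (hu s hs.1).continuousAt.continuousWithinAt
  obtain ⟨s, hs, hz⟩ := intermediate_value_Icc' ht hc ⟨hle, h0.le⟩
  exact hne s hs.1 hz

/-- Along the coupled flow `u' = (k+2) u^(k+1) g`, `v' = -(k+2) v^(k+1) g` started at `(α, α)`,
the product `u v` stays at least `α²`. -/
lemma sq_le_mul_of_coupled_flow {u v g : ℝ → ℝ} {k : ℕ} {α : ℝ} (hα : 0 < α)
    (hg : ContinuousOn g (Set.Ici 0))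
    (hu : ∀ t, 0 ≤ t → HasDerivAt u ((k + 2 : ℝ) * u t ^ (k + 1) * g t) t)
    (hv : ∀ t, 0 ≤ t → HasDerivAt v (-((k + 2 : ℝ) * v t ^ (k + 1) * g t)) t)
    (hu0 : u 0 = α) (hv0 : v 0 = α) {t : ℝ} (ht : 0 ≤ t) :
    0 < u t ∧ 0 < v t ∧ α ^ 2 ≤ u t * v t := by
  have hcu : ContinuousOn u (Set.Ici 0) :=
    fun s hs => (hu s hs).continuousAt.continuousWithinAt
  have hcv : ContinuousOn v (Set.Ici 0) :=
    fun s hs => (hv s hs).continuousAt.continuousWithinAt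
  have hup : ∀ s, 0 ≤ s → 0 < u s := fun s hs =>
    pos_of_hasDerivAt_mul_self (a := fun s => (k + 2 : ℝ) * u s ^ k * g s)
      ((continuousOn_const.mul (hcu.pow k)).mul hg)
      (fun s hs => by convert hu s hs using 1; ring) (hu0 ▸ hα) hs
  have hvp : ∀ s, 0 ≤ s → 0 < v s := fun s hs =>
    pos_of_hasDerivAt_mul_self (a := fun s => -((k + 2 : ℝ) * v s ^ k * g s))
      ((continuousOn_const.mul (hcv.pow k)).mul hg).neg
      (fun s hs => by convert hv s hs using 1; ring) (hv0 ▸ hα) hs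
  refine ⟨hup t ht, hvp t ht, ?_⟩
  rcases Nat.eq_zero_or_pos k with rfl | hk
  · have h := eq_zero_time_of_hasDerivAt_zero (fun s hs (_ : s ≤ t) => (hu s hs).mul (hv s hs))
      (fun s _ _ => by simp; ring) ht
    simp only [Pi.mul_apply, hu0, hv0] at h
    rw [h, sq]
  · have h := eq_zero_time_of_hasDerivAt_zero
      (fun s hs (_ : s ≤ t) => (((hu s hs).pow k).inv (pow_pos (hup s hs) k).ne').add
        (((hv s hs).pow k).inv (pow_pos (hvp s hs) k).ne'))
      (fun s hs _ => by
        have h₁ := (hup s hs).ne'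
        have h₂ := (hvp s hs).ne'
        obtain ⟨m, rfl⟩ : ∃ m, k = m + 1 := ⟨k - 1, by omega⟩
        simp only [Pi.pow_apply, Nat.add_sub_cancel]
        field_simp
        ring) ht
    simp only [Pi.add_apply, Pi.inv_apply, Pi.pow_apply, hu0, hv0] at h
    have hU := pow_pos (hup t ht) k
    have hV := pow_pos (hvp t ht) k
    have hA := pow_pos hα k
    have key : (α ^ k) ^ 2 ≤ u t ^ k * v t ^ k := by
      have e : (u t ^ k + v t ^ k) * α ^ k = 2 * (u t ^ k * v t ^ k) := by
        field_simp at h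
        linarith
      have h4 : (2 * (u t ^ k * v t ^ k)) ^ 2 ≥ 4 * (u t ^ k * v t ^ k) * (α ^ k) ^ 2 := by
        rw [← e, mul_pow]
        exact mul_le_mul_of_nonneg_right
          (by nlinarith [sq_nonneg (u t ^ k - v t ^ k)]) (sq_nonneg _)
      have hUV := mul_pos hU hV
      nlinarith
    rw [← mul_pow, ← pow_mul, mul_comm k 2, pow_mul] at key
    exact le_of_pow_le_pow_left₀ hk.ne' (mul_pos (hup t ht) (hvp t ht)).le key

/-- If `α² ≤ a b` with `a, b` positive then `2 α^(2m) ≤ a^(2m) + b^(2m)`. -/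
lemma two_mul_pow_le_add_pow {a b α : ℝ} (m : ℕ) (h : α ^ 2 ≤ a * b) :
    2 * α ^ (2 * m) ≤ (a ^ m) ^ 2 + (b ^ m) ^ 2 := by
  have h₁ : α ^ (2 * m) ≤ a ^ m * b ^ m := by
    rw [pow_mul, ← mul_pow]
    exact pow_le_pow_left₀ (sq_nonneg α) h m
  nlinarith [sq_nonneg (a ^ m - b ^ m)]

open Real Finset Filter Topology MeasureTheory

theorem stmt0
    (d N D : ℕ) (hd : 0 < d) (hN : 0 < N) (hD : 2 ≤ D)
    (x : Fin N → Fin d → ℝ)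
    (γ₂ : ℝ) (hγ₂pos : 0 < γ₂)
    (hγ₂ : IsGreatest {g : ℝ | ∃ v : Fin d → ℝ, (∑ i, (v i)^2) = 1 ∧ ∀ n, g ≤ ∑ i, x n i * v i} γ₂)
    (α : ℝ) (hα : 0 < α)
    (up um : ℝ → Fin d → ℝ)
    (hinit : ∀ i, up 0 i = α ∧ um 0 i = α)
    (w : ℝ → Fin d → ℝ)
    (hw : ∀ t i, w t i = (up t i)^D - (um t i)^D)
    (hflowp : ∀ t, 0 ≤ t → ∀ i, HasDerivAt (fun s => up s i)
        (((D:ℝ)/(N:ℝ)) * (up t i)^(D-1) * ∑ n, Real.exp (-(∑ j, x n j * w t j)) * x n i) t)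
    (hflowm : ∀ t, 0 ≤ t → ∀ i, HasDerivAt (fun s => um s i)
        (-(((D:ℝ)/(N:ℝ)) * (um t i)^(D-1) * ∑ n, Real.exp (-(∑ j, x n j * w t j)) * x n i)) t)
    (Lf : ℝ → ℝ)
    (hLf : ∀ t, Lf t = (1 / (N:ℝ)) * ∑ n, Real.exp (-(∑ i, x n i * w t i)))
    (t : ℝ) (ht : 0 ≤ t)
    :
    Lf t ≤ 1 / (1 + 2 * (D:ℝ)^2 * α^(2*D-2) * γ₂^2 * t) := by
  obtain ⟨k, rfl⟩ : ∃ k, D = k + 2 := ⟨D - 2, by omega⟩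
  have hNpos : (0 : ℝ) < N := by exact_mod_cast hN
  obtain ⟨⟨v, hv1, hvx⟩, -⟩ := hγ₂
  set c : ℝ := 2 * ((k + 2 : ℕ) : ℝ) ^ 2 * α ^ (2 * (k + 2) - 2) * γ₂ ^ 2 with hc
  have hcpos : 0 < c := by positivity
  let g : Fin d → ℝ → ℝ :=
    fun i s => (1 / (N : ℝ)) * ∑ n, Real.exp (-(∑ j, x n j * w s j)) * x n i
  have hup : ∀ i s, 0 ≤ s → HasDerivAt (fun s => up s i)
      ((k + 2 : ℝ) * up s i ^ (k + 1) * g i s) s := fun i s hs => by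
    convert hflowp s hs i using 1
    simp only [g, Nat.add_succ_sub_one]
    push_cast
    ring
  have hum : ∀ i s, 0 ≤ s → HasDerivAt (fun s => um s i)
      (-((k + 2 : ℝ) * um s i ^ (k + 1) * g i s)) s := fun i s hs => by
    convert hflowm s hs i using 1
    simp only [g, Nat.add_succ_sub_one]
    push_cast
    ring
  have hwd : ∀ i s, 0 ≤ s → HasDerivAt (fun s => w s i)
      ((k + 2 : ℝ) ^ 2 * ((up s i ^ (k + 1)) ^ 2 + (um s i ^ (k + 1)) ^ 2) * g i s) s :=
    fun i s hs => by
    have h := ((hup i s hs).pow (k + 2)).sub ((hum i s hs).pow (k + 2))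
    have e : (fun s => w s i) = (fun s => up s i) ^ (k + 2) - (fun s => um s i) ^ (k + 2) := by
      funext s
      simp [hw]
    rw [e]
    refine h.congr_deriv ?_
    simp only [Nat.add_succ_sub_one]
    push_cast
    ring
  have hgc : ∀ i, ContinuousOn (g i) (Set.Ici 0) := by
    intro i
    have hwc : ∀ j, ContinuousOn (fun s => w s j) (Set.Ici 0) :=
      fun j s hs => (hwd j s hs).continuousAt.continuousWithinAt
    simp only [g]
    fun_prop
  have hprod : ∀ i s, 0 ≤ s → α ^ 2 ≤ up s i * um s i := fun i s hs =>
    (sq_le_mul_of_coupled_flow (u := fun s => up s i) (v := fun s => um s i) hα (hgc i) (hup i)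
      (hum i) (hinit i).1 (hinit i).2 hs).2.2
  have hLpos : ∀ s, 0 < Lf s := fun s => by
    have : Nonempty (Fin N) := ⟨⟨0, hN⟩⟩
    rw [hLf]
    exact mul_pos (by positivity)
      (Finset.sum_pos (fun n _ => Real.exp_pos _) Finset.univ_nonempty)
  have hLd : ∀ s, 0 ≤ s → HasDerivAt Lf
      (-∑ i, (k + 2 : ℝ) ^ 2 * ((up s i ^ (k + 1)) ^ 2 + (um s i ^ (k + 1)) ^ 2) * g i s ^ 2)
      s := fun s hs => by
    have h : HasDerivAt (fun s => (1 / (N : ℝ)) * ∑ n, Real.exp (-(∑ i, x n i * w s i))) _ s :=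
      (HasDerivAt.fun_sum (u := Finset.univ) fun n _ =>
        (HasDerivAt.fun_sum (u := Finset.univ) fun i _ =>
          (hwd i s hs).const_mul (x n i)).fun_neg.exp).const_mul (1 / (N : ℝ))
    rw [show Lf = _ from funext hLf]
    convert h using 1
    simp only [mul_neg, Finset.sum_neg_distrib, neg_inj, Finset.mul_sum]
    rw [Finset.sum_comm]
    refine Finset.sum_congr rfl fun i _ => ?_
    rw [sq (g i s)]
    conv_lhs => rw [← mul_assoc]; enter [2]; simp only [g]
    rw [Finset.mul_sum, Finset.mul_sum]
    exact Finset.sum_congr rfl fun n _ => by ring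
  have hmargin : ∀ s, (γ₂ * Lf s) ^ 2 ≤ ∑ i, g i s ^ 2 := fun s => by
    have h₁ : γ₂ * Lf s ≤ ∑ i, g i s * v i := by
      have e : ∑ i, g i s * v i
          = (1 / (N : ℝ)) * ∑ n, Real.exp (-(∑ j, x n j * w s j)) * ∑ i, x n i * v i := by
        simp only [g, Finset.mul_sum, Finset.sum_mul]
        rw [Finset.sum_comm]
        exact Finset.sum_congr rfl fun n _ => Finset.sum_congr rfl fun i _ => by ring
      rw [e, hLf, mul_left_comm, Finset.mul_sum]
      refine mul_le_mul_of_nonneg_left (Finset.sum_le_sum fun n _ => ?_) (by positivity)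
      rw [mul_comm]
      exact mul_le_mul_of_nonneg_left (hvx n) (Real.exp_pos _).le
    calc (γ₂ * Lf s) ^ 2 ≤ (∑ i, g i s * v i) ^ 2 :=
          pow_le_pow_left₀ (mul_pos hγ₂pos (hLpos s)).le h₁ 2
      _ ≤ (∑ i, g i s ^ 2) * ∑ i, v i ^ 2 := Finset.sum_mul_sq_le_sq_mul_sq _ _ _
      _ = ∑ i, g i s ^ 2 := by rw [hv1, mul_one]
  have hdecay : ∀ s, 0 ≤ s → c * Lf s ^ 2 ≤
      ∑ i, (k + 2 : ℝ) ^ 2 * ((up s i ^ (k + 1)) ^ 2 + (um s i ^ (k + 1)) ^ 2) * g i s ^ 2 := by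
    intro s hs
    calc c * Lf s ^ 2 = (k + 2 : ℝ) ^ 2 * (2 * α ^ (2 * (k + 1))) * (γ₂ * Lf s) ^ 2 := by
          rw [hc, show 2 * (k + 2) - 2 = 2 * (k + 1) by omega]
          push_cast
          ring
      _ ≤ (k + 2 : ℝ) ^ 2 * (2 * α ^ (2 * (k + 1))) * ∑ i, g i s ^ 2 :=
          mul_le_mul_of_nonneg_left (hmargin s) (by positivity)
      _ ≤ _ := by
          rw [Finset.mul_sum]
          refine Finset.sum_le_sum fun i _ => ?_
          have := two_mul_pow_le_add_pow (k + 1) (hprod i s hs)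
          gcongr
  have hL0 : Lf 0 = 1 := by
    have : ∀ i, w 0 i = 0 := fun i => by rw [hw, (hinit i).1, (hinit i).2, sub_self]
    rw [hLf]
    simp [this, hNpos.ne']
  have hmain := add_mul_le_of_le_hasDerivAt (c := c) (t := t)
    (fun s hs _ => (hLd s hs).inv (hLpos s).ne')
    (fun s hs _ => by
      rw [neg_neg, le_div_iff₀ (pow_pos (hLpos s) 2)]
      exact hdecay s hs) ht
  simp only [Pi.inv_apply, hL0, inv_one] at hmain
  rw [le_div_iff₀ (by positivity), mul_comm, ← le_div_iff₀ (hLpos t), one_div]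
  exact hmain
end

section
/- For D = 2 and every t ≥ 0, the linear predictor implemented by the gradient-flow trajectory admits the closed form w(t) = 2α² sinh(4 X ∫₀ᵗ r(s) ds), where sinh is applied coordinatewise. -/
/-- A solution of the scalar linear equation `f' = c G' f` on `[0, ∞)` with `G 0 = 0` is
`f 0 * exp (c * G)`. -/
theorem eq_mul_exp_of_hasDerivAt {f G g : ℝ → ℝ} {c : ℝ} (hG0 : G 0 = 0)
    (hf : ∀ t, 0 ≤ t → HasDerivAt f (c * g t * f t) t)
    (hG : ∀ t, 0 ≤ t → HasDerivAt G (g t) t) {t : ℝ} (ht : 0 ≤ t) :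
    f t = f 0 * Real.exp (c * G t) := by
  have hder : ∀ s, 0 ≤ s → HasDerivAt (fun s => f s * Real.exp (-(c * G s))) 0 s := by
    intro s hs
    refine ((hf s hs).fun_mul ((hG s hs).const_mul c).fun_neg.exp).congr_deriv ?_
    ring
  have hconst := constant_of_has_deriv_right_zero (a := 0) (b := t)
    (fun s hs => (hder s hs.1).continuousAt.continuousWithinAt)
    (fun s hs => (hder s hs.1).hasDerivWithinAt) t ⟨ht, le_rfl⟩
  simp only [hG0, mul_zero, neg_zero, Real.exp_zero, mul_one] at hconst
  rw [← hconst, mul_assoc, ← Real.exp_add, neg_add_cancel, Real.exp_zero, mul_one]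

/-- A function continuous at every point of `[0, ∞)` becomes continuous on `ℝ` after being
extended by its value at `0`. -/
theorem continuous_comp_max_zero {f : ℝ → ℝ} (hf : ∀ t, 0 ≤ t → ContinuousAt f t) :
    Continuous fun t => f (max 0 t) :=
  continuous_iff_continuousAt.2 fun t =>
    ContinuousAt.comp (f := fun t : ℝ => max 0 t) (hf _ (le_max_left 0 t))
      (continuous_const.max continuous_id).continuousAt


open Real Finset Filter Topology MeasureTheory

theorem stmt1
    (d N D : ℕ) (hd : 0 < d) (hN : 0 < N) (hD : 2 ≤ D) (hD2 : D = 2)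
    (x : Fin N → Fin d → ℝ)
    (γ₂ : ℝ) (hγ₂pos : 0 < γ₂)
    (hγ₂ : IsGreatest {g : ℝ | ∃ v : Fin d → ℝ, (∑ i, (v i)^2) = 1 ∧ ∀ n, g ≤ ∑ i, x n i * v i} γ₂)
    (α : ℝ) (hα : 0 < α)
    (up um : ℝ → Fin d → ℝ)
    (hinit : ∀ i, up 0 i = α ∧ um 0 i = α)
    (w : ℝ → Fin d → ℝ)
    (hw : ∀ t i, w t i = (up t i)^D - (um t i)^D)
    (hflowp : ∀ t, 0 ≤ t → ∀ i, HasDerivAt (fun s => up s i)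
        (((D:ℝ)/(N:ℝ)) * (up t i)^(D-1) * ∑ n, Real.exp (-(∑ j, x n j * w t j)) * x n i) t)
    (hflowm : ∀ t, 0 ≤ t → ∀ i, HasDerivAt (fun s => um s i)
        (-(((D:ℝ)/(N:ℝ)) * (um t i)^(D-1) * ∑ n, Real.exp (-(∑ j, x n j * w t j)) * x n i)) t)
    (r : ℝ → Fin N → ℝ)
    (hr : ∀ t n, r t n = (1 / (N:ℝ)) * Real.exp (-(∑ i, x n i * w t i)))
    :
    ∀ t : ℝ, 0 ≤ t → ∀ i : Fin d,
      w t i = 2 * α^2 * Real.sinh (4 * ∑ n, (∫ s in (0:ℝ)..t, r s n) * x n i) := by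
  subst hD2
  have hrc : ∀ n t, 0 ≤ t → ContinuousAt (fun s => r s n) t := by
    intro n t ht
    have hup : ∀ i, ContinuousAt (fun s => up s i) t := fun i => (hflowp t ht i).continuousAt
    have hum : ∀ i, ContinuousAt (fun s => um s i) t := fun i => (hflowm t ht i).continuousAt
    simp only [hr, hw]
    fun_prop
  set G : Fin d → ℝ → ℝ := fun i t => ∑ n, (∫ s in (0:ℝ)..t, r (max 0 s) n) * x n i with hGdef
  have hG0 : ∀ i, G i 0 = 0 := by simp [hGdef]
  have hG : ∀ i t, 0 ≤ t → HasDerivAt (G i) (∑ n, r t n * x n i) t := by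
    intro i t ht
    refine HasDerivAt.fun_sum fun n _ => ?_
    have hc := continuous_comp_max_zero (hrc n)
    have h := (hc.integral_hasStrictDerivAt 0 t).hasDerivAt
    rw [max_eq_right ht] at h
    exact h.mul_const _
  have hsum : ∀ t i, ∑ n, r t n * x n i
      = (1 / (N:ℝ)) * ∑ n, Real.exp (-(∑ j, x n j * w t j)) * x n i := by
    intro t i
    simp only [hr, Finset.mul_sum, mul_assoc]
  intro t ht i
  have hp : up t i = α * Real.exp (2 * G i t) := by
    rw [← (hinit i).1]
    refine eq_mul_exp_of_hasDerivAt (f := fun s => up s i) (hG0 i) (fun s hs => ?_) (hG i) ht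
    convert hflowp s hs i using 1
    rw [hsum]
    push_cast
    ring
  have hm : um t i = α * Real.exp (-2 * G i t) := by
    rw [← (hinit i).2]
    refine eq_mul_exp_of_hasDerivAt (f := fun s => um s i) (hG0 i) (fun s hs => ?_) (hG i) ht
    convert hflowm s hs i using 1
    rw [hsum]
    push_cast
    ring
  have hGt : ∑ n, (∫ s in (0:ℝ)..t, r s n) * x n i = G i t := by
    refine Finset.sum_congr rfl fun n _ => ?_
    congr 1
    refine intervalIntegral.integral_congr fun s hs => ?_
    rw [Set.uIcc_of_le ht] at hs
    simp only [max_eq_right hs.1]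
  rw [hGt, hw, hp, hm, mul_pow, mul_pow, ← Real.exp_nat_mul, ← Real.exp_nat_mul, Real.sinh_eq]
  push_cast
  ring_nf
end

section
/- For D = 2, every t ≥ 0, and every coordinate i ∈ {1,…,d}, the linear predictor w(t) implemented by the gradient-flow trajectory satisfies the differential equation d/dt wᵢ(t) = 4 √(wᵢ(t)² + 4α⁴) · [X r(t)]ᵢ. -/
open Real Finset Filter Topology MeasureTheory

/-- If two functions have logarithmic derivatives of opposite sign on `[0, ∞)`, then their product
is conserved there. -/
theorem mul_eq_of_opposite_log_deriv {p m c : ℝ → ℝ}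
    (hp : ∀ t, 0 ≤ t → HasDerivAt p (c t * p t) t)
    (hm : ∀ t, 0 ≤ t → HasDerivAt m (-(c t * m t)) t) {t : ℝ} (ht : 0 ≤ t) :
    p t * m t = p 0 * m 0 := by
  have h : ∀ s, 0 ≤ s → HasDerivAt (fun s => p s * m s) 0 s := fun s hs =>
    ((hp s hs).mul (hm s hs)).congr_deriv (by ring)
  exact constant_of_has_deriv_right_zero
    (fun s hs => (h s hs.1).continuousAt.continuousWithinAt)
    (fun s hs => (h s hs.1).hasDerivWithinAt) t ⟨ht, le_rfl⟩

theorem stmt2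
    (d N D : ℕ) (hd : 0 < d) (hN : 0 < N) (hD : 2 ≤ D) (hD2 : D = 2)
    (x : Fin N → Fin d → ℝ)
    (γ₂ : ℝ) (hγ₂pos : 0 < γ₂)
    (hγ₂ : IsGreatest {g : ℝ | ∃ v : Fin d → ℝ, (∑ i, (v i)^2) = 1 ∧ ∀ n, g ≤ ∑ i, x n i * v i} γ₂)
    (α : ℝ) (hα : 0 < α)
    (up um : ℝ → Fin d → ℝ)
    (hinit : ∀ i, up 0 i = α ∧ um 0 i = α)
    (w : ℝ → Fin d → ℝ)
    (hw : ∀ t i, w t i = (up t i)^D - (um t i)^D)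
    (hflowp : ∀ t, 0 ≤ t → ∀ i, HasDerivAt (fun s => up s i)
        (((D:ℝ)/(N:ℝ)) * (up t i)^(D-1) * ∑ n, Real.exp (-(∑ j, x n j * w t j)) * x n i) t)
    (hflowm : ∀ t, 0 ≤ t → ∀ i, HasDerivAt (fun s => um s i)
        (-(((D:ℝ)/(N:ℝ)) * (um t i)^(D-1) * ∑ n, Real.exp (-(∑ j, x n j * w t j)) * x n i)) t)
    (r : ℝ → Fin N → ℝ)
    (hr : ∀ t n, r t n = (1 / (N:ℝ)) * Real.exp (-(∑ i, x n i * w t i)))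
    :
    ∀ t : ℝ, 0 ≤ t → ∀ i : Fin d,
      HasDerivAt (fun s => w s i)
        (4 * Real.sqrt ((w t i)^2 + 4 * α^4) * ∑ n, r t n * x n i) t := by
  subst hD2
  intro t ht i
  have hprod : up t i * um t i = α ^ 2 := by
    have h := mul_eq_of_opposite_log_deriv (p := fun s => up s i) (m := fun s => um s i)
      (c := fun s => 2 / (N : ℝ) * ∑ n, Real.exp (-(∑ j, x n j * w s j)) * x n i)
      (fun s hs => (hflowp s hs i).congr_deriv (by norm_num; ring))
      (fun s hs => (hflowm s hs i).congr_deriv (by norm_num; ring)) ht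
    simpa only [(hinit i).1, (hinit i).2, ← sq] using h
  have hsqrt : Real.sqrt ((w t i) ^ 2 + 4 * α ^ 4) = (up t i) ^ 2 + (um t i) ^ 2 := by
    rw [← Real.sqrt_sq (by positivity : 0 ≤ (up t i) ^ 2 + (um t i) ^ 2), hw,
      show α ^ 4 = (up t i * um t i) ^ 2 by rw [hprod]; ring]
    congr 1
    ring
  have hsum : ∑ n, r t n * x n i
      = 1 / (N : ℝ) * ∑ n, Real.exp (-(∑ j, x n j * w t j)) * x n i := by
    simp only [hr, mul_assoc, Finset.mul_sum]
  rw [hsqrt, hsum]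
  simp only [hw _ i]
  refine (((hflowp t ht i).fun_pow 2).sub ((hflowm t ht i).fun_pow 2)).congr_deriv ?_
  norm_num
  ring
end

section
/- For D = 2 and every t ≥ 0, the gradient-flow trajectory satisfies ‖w(t)‖_∞ ≤ 2α² sinh( (x̄ / (2 γ₂² α²)) · γ̃(t) ). -/
open Real Finset Filter Topology MeasureTheory

/-- A function vanishing nowhere on `[0, ∞)` and positive at `0` stays positive. -/
theorem pos_of_ne_zero_of_continuousOn_Ici {f : ℝ → ℝ} (hf : ContinuousOn f (Set.Ici 0))
    (h0 : 0 < f 0) (hne : ∀ t, 0 ≤ t → f t ≠ 0) {t : ℝ} (ht : 0 ≤ t) : 0 < f t := by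
  by_contra! h
  obtain ⟨s, hs, hs0⟩ := intermediate_value_Icc' ht (hf.mono fun _ hx => hx.1) ⟨h, h0.le⟩
  exact hne s hs.1 hs0

/-- A function with nonnegative derivative on `[0, ∞)` lies above its initial value. -/
theorem le_of_hasDerivAt_nonneg_Ici {f f' : ℝ → ℝ} (hf : ∀ t, 0 ≤ t → HasDerivAt f (f' t) t)
    (hf' : ∀ t, 0 ≤ t → 0 ≤ f' t) {t : ℝ} (ht : 0 ≤ t) : f 0 ≤ f t := by
  refine monotoneOn_of_deriv_nonneg (convex_Ici 0)
    (fun s hs => (hf s hs).continuousAt.continuousWithinAt)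
    (fun s hs => (hf s (interior_subset hs)).differentiableAt.differentiableWithinAt)
    (fun s hs => ?_) Set.self_mem_Ici ht ht
  rw [(hf s (interior_subset hs)).deriv]
  exact hf' s (interior_subset hs)

/-- Solutions of `p' = g p`, `m' = -g m` with the same positive initial value `a` stay positive
and satisfy `p m = a ^ 2`. -/
theorem pos_and_mul_eq_of_opposite_linear_flow {p m g : ℝ → ℝ} {a : ℝ} (ha : 0 < a)
    (hp0 : p 0 = a) (hm0 : m 0 = a) (hp : ∀ t, 0 ≤ t → HasDerivAt p (g t * p t) t)
    (hm : ∀ t, 0 ≤ t → HasDerivAt m (-(g t * m t)) t) {t : ℝ} (ht : 0 ≤ t) :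
    0 < p t ∧ 0 < m t ∧ p t * m t = a ^ 2 := by
  have hprod : ∀ s, 0 ≤ s → p s * m s = a ^ 2 := by
    intro s hs
    have hd : ∀ r, 0 ≤ r → HasDerivAt (fun r => p r * m r) 0 r := fun r hr =>
      ((hp r hr).mul (hm r hr)).congr_deriv (by ring)
    have h1 := le_of_hasDerivAt_nonneg_Ici hd (fun _ _ => le_rfl) hs
    have h2 := le_of_hasDerivAt_nonneg_Ici (fun r hr => (hd r hr).neg) (fun _ _ => by simp) hs
    simp only [Pi.neg_apply, hp0, hm0] at h1 h2
    linarith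
  have hne : ∀ s, 0 ≤ s → p s ≠ 0 ∧ m s ≠ 0 := fun s hs =>
    mul_ne_zero_iff.mp (by rw [hprod s hs]; positivity)
  exact ⟨pos_of_ne_zero_of_continuousOn_Ici
      (fun s hs => (hp s hs).continuousAt.continuousWithinAt) (hp0 ▸ ha)
      (fun s hs => (hne s hs).1) ht,
    pos_of_ne_zero_of_continuousOn_Ici
      (fun s hs => (hm s hs).continuousAt.continuousWithinAt) (hm0 ▸ ha)
      (fun s hs => (hne s hs).2) ht, hprod t ht⟩

/-- If `p m = a ^ 2`, then `p ^ 2 - m ^ 2` is a hyperbolic sine of the log-ratio. -/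
theorem sq_sub_sq_eq_sinh_log_sub_log {p m a : ℝ} (hp : 0 < p) (hm : 0 < m) (h : p * m = a ^ 2) :
    p ^ 2 - m ^ 2 = 2 * a ^ 2 * Real.sinh (Real.log p - Real.log m) := by
  rw [Real.sinh_eq, neg_sub, Real.exp_sub, Real.exp_sub, Real.exp_log hp, Real.exp_log hm, ← h]
  field_simp

/-- A margin `c` bounds the norm of a nonnegative combination of the data from below. -/
theorem margin_mul_sum_sq_le {ι κ : Type*} [Fintype ι] [Fintype κ] {x : κ → ι → ℝ} {c : ℝ}
    (hc : 0 ≤ c) {v : ι → ℝ} (hv : ∑ i, v i ^ 2 = 1) (hcv : ∀ n, c ≤ ∑ i, x n i * v i)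
    {r : κ → ℝ} (hr : ∀ n, 0 ≤ r n) :
    (c * ∑ n, r n) ^ 2 ≤ ∑ i, (∑ n, r n * x n i) ^ 2 := by
  have h1 : c * ∑ n, r n ≤ ∑ i, (∑ n, r n * x n i) * v i := by
    calc c * ∑ n, r n = ∑ n, r n * c := by rw [mul_comm, Finset.sum_mul]
      _ ≤ ∑ n, r n * ∑ i, x n i * v i :=
        Finset.sum_le_sum fun n _ => mul_le_mul_of_nonneg_left (hcv n) (hr n)
      _ = ∑ i, (∑ n, r n * x n i) * v i := by
        simp only [Finset.mul_sum, Finset.sum_mul]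
        rw [Finset.sum_comm]
        simp only [mul_assoc]
  have h2 := Finset.sum_mul_sq_le_sq_mul_sq Finset.univ (fun i => ∑ n, r n * x n i) v
  rw [hv, mul_one] at h2
  exact (pow_le_pow_left₀ (mul_nonneg hc (Finset.sum_nonneg fun n _ => hr n)) h1 2).trans h2

/-- `ℓ¹`-`ℓ^∞` bound for a sum with nonnegative weights. -/
theorem abs_sum_mul_le_sum_abs_mul_sum {κ : Type*} [Fintype κ] {r y : κ → ℝ} (hr : ∀ n, 0 ≤ r n) :
    |∑ n, r n * y n| ≤ (∑ n, |y n|) * ∑ n, r n := by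
  calc |∑ n, r n * y n| ≤ ∑ n, |r n * y n| := Finset.abs_sum_le_sum_abs _ _
    _ ≤ ∑ n, |y n| * ∑ k, r k := Finset.sum_le_sum fun n _ => by
      rw [abs_mul, abs_of_nonneg (hr n), mul_comm]
      exact mul_le_mul_of_nonneg_left
        (Finset.single_le_sum (fun k _ => hr k) (Finset.mem_univ n)) (abs_nonneg _)
    _ = (∑ n, |y n|) * ∑ n, r n := by rw [Finset.sum_mul]

theorem stmt3
    (d N D : ℕ) (hd : 0 < d) (hN : 0 < N) (hD : 2 ≤ D) (hD2 : D = 2)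
    (x : Fin N → Fin d → ℝ)
    (γ₂ : ℝ) (hγ₂pos : 0 < γ₂)
    (hγ₂ : IsGreatest {g : ℝ | ∃ v : Fin d → ℝ, (∑ i, (v i)^2) = 1 ∧ ∀ n, g ≤ ∑ i, x n i * v i} γ₂)
    (α : ℝ) (hα : 0 < α)
    (up um : ℝ → Fin d → ℝ)
    (hinit : ∀ i, up 0 i = α ∧ um 0 i = α)
    (w : ℝ → Fin d → ℝ)
    (hw : ∀ t i, w t i = (up t i)^D - (um t i)^D)
    (hflowp : ∀ t, 0 ≤ t → ∀ i, HasDerivAt (fun s => up s i)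
        (((D:ℝ)/(N:ℝ)) * (up t i)^(D-1) * ∑ n, Real.exp (-(∑ j, x n j * w t j)) * x n i) t)
    (hflowm : ∀ t, 0 ≤ t → ∀ i, HasDerivAt (fun s => um s i)
        (-(((D:ℝ)/(N:ℝ)) * (um t i)^(D-1) * ∑ n, Real.exp (-(∑ j, x n j * w t j)) * x n i)) t)
    (Lf : ℝ → ℝ)
    (hLf : ∀ t, Lf t = (1 / (N:ℝ)) * ∑ n, Real.exp (-(∑ i, x n i * w t i)))
    (xbar : ℝ)
    (hxbar : IsGreatest {v : ℝ | ∃ i : Fin d, v = ∑ n, |x n i|} xbar)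
    :
    ∀ t : ℝ, 0 ≤ t → ∀ i : Fin d,
      |w t i| ≤ 2 * α^2 * Real.sinh ((xbar / (2 * γ₂^2 * α^2)) * (-Real.log (Lf t))) := by
  subst hD2
  have hN' : (0 : ℝ) < N := by exact_mod_cast hN
  have : Nonempty (Fin N) := ⟨⟨0, hN⟩⟩
  obtain ⟨⟨v, hv, hmargin⟩, -⟩ := hγ₂
  let r : ℝ → Fin N → ℝ := fun t n => (1 / (N : ℝ)) * Real.exp (-(∑ j, x n j * w t j))
  let S : ℝ → Fin d → ℝ := fun t i => ∑ n, r t n * x n i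
  have hr : ∀ t n, 0 < r t n := fun t n => by positivity
  have hL : ∀ t, Lf t = ∑ n, r t n := fun t => by rw [hLf, Finset.mul_sum]
  have hLpos : ∀ t, 0 < Lf t := fun t => by
    rw [hL]
    exact Finset.sum_pos (fun n _ => hr t n) Finset.univ_nonempty
  have hS : ∀ t i, ∑ n, Real.exp (-(∑ j, x n j * w t j)) * x n i = N * S t i := fun t i => by
    simp only [S, r, Finset.mul_sum]
    refine Finset.sum_congr rfl fun n _ => ?_
    field_simp
  have hp : ∀ i t, 0 ≤ t → HasDerivAt (fun s => up s i) (2 * S t i * up t i) t := fun i t ht => by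
    convert hflowp t ht i using 1
    rw [hS]
    push_cast
    field_simp
  have hm : ∀ i t, 0 ≤ t → HasDerivAt (fun s => um s i) (-(2 * S t i * um t i)) t := by
    intro i t ht
    convert hflowm t ht i using 1
    rw [hS]
    push_cast
    field_simp
  have hpm : ∀ i t, 0 ≤ t → 0 < up t i ∧ 0 < um t i ∧ up t i * um t i = α ^ 2 := fun i t ht =>
    pos_and_mul_eq_of_opposite_linear_flow (g := fun t => 2 * S t i) hα (hinit i).1 (hinit i).2
      (hp i) (hm i) ht
  have hwd : ∀ i t, 0 ≤ t →
      HasDerivAt (fun s => w s i) (4 * (up t i ^ 2 + um t i ^ 2) * S t i) t := fun i t ht => by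
    simp only [hw]
    exact (((hp i t ht).fun_pow 2).sub ((hm i t ht).fun_pow 2)).congr_deriv (by push_cast; ring)
  let Q : ℝ → ℝ := fun t => ∑ i, 4 * (up t i ^ 2 + um t i ^ 2) * S t i ^ 2
  have hLd : ∀ t, 0 ≤ t → HasDerivAt Lf (-Q t) t := fun t ht => by
    have hLf' : Lf = fun s => ∑ n, r s n := funext hL
    rw [hLf']
    have h : HasDerivAt (fun s => ∑ n, r s n)
        (∑ n, (1 / (N : ℝ)) * (Real.exp (-(∑ j, x n j * w t j)) *
          -(∑ j, x n j * (4 * (up t j ^ 2 + um t j ^ 2) * S t j)))) t :=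
      HasDerivAt.fun_sum fun n _ => (((HasDerivAt.fun_sum fun j _ =>
        (hwd j t ht).const_mul (x n j)).neg.exp).const_mul _)
    convert h using 1
    calc -Q t = -∑ j, ∑ n, r t n * x n j * (4 * (up t j ^ 2 + um t j ^ 2) * S t j) := by
          congr 1
          refine Finset.sum_congr rfl fun j _ => ?_
          rw [← Finset.sum_mul]
          change _ = S t j * _
          ring
      _ = _ := by
          rw [Finset.sum_comm, ← Finset.sum_neg_distrib]
          refine Finset.sum_congr rfl fun n _ => ?_
          rw [← mul_assoc, mul_neg, Finset.mul_sum]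
          simp only [r, mul_assoc]
  have hQ : ∀ t, 0 ≤ t → 8 * α ^ 2 * (γ₂ * Lf t) ^ 2 ≤ Q t := fun t ht => by
    have h := margin_mul_sum_sq_le hγ₂pos.le hv hmargin (fun n => (hr t n).le)
    rw [← hL] at h
    calc 8 * α ^ 2 * (γ₂ * Lf t) ^ 2 ≤ 8 * α ^ 2 * ∑ i, S t i ^ 2 := by gcongr
      _ ≤ Q t := by
        rw [Finset.mul_sum]
        refine Finset.sum_le_sum fun i _ => mul_le_mul_of_nonneg_right ?_ (sq_nonneg _)
        rw [← (hpm i t ht).2.2]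
        nlinarith [sq_nonneg (up t i - um t i)]
  have hL0 : Lf 0 = 1 := by
    have hw0 : ∀ i, w 0 i = 0 := fun i => by rw [hw, (hinit i).1, (hinit i).2, sub_self]
    rw [hLf]
    simp [hw0, hN'.ne']
  intro t ht i
  have hx : ∑ n, |x n i| ≤ xbar := hxbar.2 ⟨i, rfl⟩
  have hxbar0 : 0 ≤ xbar := (Finset.sum_nonneg fun n _ => abs_nonneg _).trans hx
  set C := xbar / (2 * γ₂ ^ 2 * α ^ 2) with hC
  have hC0 : 0 ≤ C := by positivity
  have hgd : ∀ s, 0 ≤ s → HasDerivAt (fun s => C * -Real.log (Lf s)) (C * (Q s / Lf s)) s :=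
    fun s hs => ((hLd s hs).log (hLpos s).ne').neg.const_mul C |>.congr_deriv (by
      rw [neg_div, neg_neg])
  have hqd : ∀ s, 0 ≤ s → HasDerivAt (fun s => Real.log (up s i) - Real.log (um s i))
      (4 * S s i) s := fun s hs => by
    obtain ⟨h1, h2, -⟩ := hpm i s hs
    refine (((hp i s hs).log h1.ne').sub ((hm i s hs).log h2.ne')).congr_deriv ?_
    field_simp
    ring
  have hbound : ∀ s, 0 ≤ s → |4 * S s i| ≤ C * (Q s / Lf s) := fun s hs => by
    have h1 : |S s i| ≤ xbar * Lf s := by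
      refine (abs_sum_mul_le_sum_abs_mul_sum fun n => (hr s n).le).trans ?_
      rw [← hL]
      exact mul_le_mul_of_nonneg_right hx (hLpos s).le
    have h2 : 8 * α ^ 2 * γ₂ ^ 2 * Lf s ≤ Q s / Lf s := by
      rw [le_div_iff₀ (hLpos s)]
      linarith [hQ s hs]
    calc |4 * S s i| = 4 * |S s i| := by rw [abs_mul, abs_of_pos (by norm_num : (0 : ℝ) < 4)]
      _ ≤ 4 * (xbar * Lf s) := by gcongr
      _ = C * (8 * α ^ 2 * γ₂ ^ 2 * Lf s) := by
        rw [hC]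
        field_simp
        ring
      _ ≤ C * (Q s / Lf s) := by gcongr
  have hupper := le_of_hasDerivAt_nonneg_Ici (fun s hs => (hgd s hs).sub (hqd s hs))
    (fun s hs => sub_nonneg.2 (abs_le.1 (hbound s hs)).2) ht
  have hlower := le_of_hasDerivAt_nonneg_Ici (fun s hs => (hgd s hs).add (hqd s hs))
    (fun s hs => by linarith [(abs_le.1 (hbound s hs)).1]) ht
  simp only [Pi.sub_apply, Pi.add_apply, hL0, (hinit i).1, (hinit i).2, Real.log_one, neg_zero,
    mul_zero, sub_self, add_zero] at hupper hlower
  obtain ⟨h1, h2, h3⟩ := hpm i t ht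
  rw [hw, sq_sub_sq_eq_sinh_log_sub_log h1 h2 h3, abs_mul,
    abs_of_nonneg (by positivity : (0 : ℝ) ≤ 2 * α ^ 2), Real.abs_sinh]
  refine mul_le_mul_of_nonneg_left (Real.sinh_le_sinh.2 (abs_le.2 ⟨?_, ?_⟩)) (by positivity)
  · linarith
  · linarith
end

section
/- For D > 2 and every t ≥ 0, every coordinate of α^{D−2} D(D−2) X ∫₀ᵗ r(s) ds lies in (−1, 1), and the linear predictor admits the closed form w(t) = α^D h_D( α^{D−2} D(D−2) X ∫₀ᵗ r(s) ds ), where h_D is applied coordinatewise. -/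
open Real Finset Filter Topology MeasureTheory

/-- A constancy principle on `[0, ∞)`. -/
theorem eq_initial_of_hasDerivAt_zero {f : ℝ → ℝ} (hf : ∀ t, 0 ≤ t → HasDerivAt f 0 t)
    {t : ℝ} (ht : 0 ≤ t) : f t = f 0 :=
  constant_of_has_deriv_right_zero
    (fun s hs => (hf s hs.1).continuousAt.continuousWithinAt)
    (fun s hs => (hf s hs.1).hasDerivWithinAt) t ⟨ht, le_rfl⟩

/-- The primitive of a function continuous on `[0, ∞)`, extended to a function differentiable
at every point of `[0, ∞)`. -/
theorem exists_primitive_of_continuousOn {g : ℝ → ℝ} (hg : ContinuousOn g (Set.Ici 0)) :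
    ∃ G : ℝ → ℝ, (∀ t, 0 ≤ t → HasDerivAt G (g t) t) ∧
      ∀ t, 0 ≤ t → G t = ∫ s in (0:ℝ)..t, g s := by
  have hc : Continuous fun s => g (max 0 s) :=
    hg.comp_continuous (by fun_prop) fun s => le_max_left 0 s
  refine ⟨fun t => ∫ s in (0:ℝ)..t, g (max 0 s), fun t ht => ?_, fun t ht => ?_⟩
  · simpa [max_eq_right ht] using (hc.integral_hasStrictDerivAt 0 t).hasDerivAt
  · refine intervalIntegral.integral_congr fun s hs => ?_
    rw [Set.uIcc_of_le ht] at hs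
    simp only [max_eq_right hs.1]

/-- A solution of the linear equation `u' = a u` with positive initial value stays positive. -/
theorem pos_of_hasDerivAt_mul {u a : ℝ → ℝ} (hu0 : 0 < u 0) (ha : ContinuousOn a (Set.Ici 0))
    (hu : ∀ t, 0 ≤ t → HasDerivAt u (a t * u t) t) {t : ℝ} (ht : 0 ≤ t) : 0 < u t := by
  obtain ⟨A, hA, hAint⟩ := exists_primitive_of_continuousOn ha
  have hconst := eq_initial_of_hasDerivAt_zero (f := fun s => u s * Real.exp (-A s))
    (fun s hs => by
      refine ((hu s hs).mul (hA s hs).neg.exp).congr_deriv ?_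
      simp only [Pi.neg_apply]
      ring) ht
  have hA0 : A 0 = 0 := by simpa using hAint 0 le_rfl
  simp only [hA0, neg_zero, Real.exp_zero, mul_one] at hconst
  exact pos_of_mul_pos_left (hconst ▸ hu0) (Real.exp_pos _).le

/-- Explicit solution of the Bernoulli equation `u' = u ^ (k + 1) g`. -/
theorem bernoulli_solution {k : ℕ} (hk : k ≠ 0) {u g : ℝ → ℝ} (hu0 : 0 < u 0)
    (hg : ContinuousOn g (Set.Ici 0))
    (hu : ∀ t, 0 ≤ t → HasDerivAt u (u t ^ (k + 1) * g t) t) {t : ℝ} (ht : 0 ≤ t) :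
    0 < u t ∧ (u t ^ k)⁻¹ = (u 0 ^ k)⁻¹ - k * ∫ s in (0:ℝ)..t, g s := by
  have hpos : ∀ s, 0 ≤ s → 0 < u s := fun s hs =>
    pos_of_hasDerivAt_mul (a := fun s => u s ^ k * g s) hu0
      (ContinuousOn.mul
        (fun s hs => ((hu s hs).continuousAt.pow k).continuousWithinAt) hg)
      (fun s hs => by convert hu s hs using 1; ring) hs
  obtain ⟨G, hG, hGint⟩ := exists_primitive_of_continuousOn hg
  have hconst := eq_initial_of_hasDerivAt_zero (f := fun s => (u s ^ k)⁻¹ + k * G s)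
    (fun s hs => by
      have hus := (hpos s hs).ne'
      refine ((((hu s hs).pow k).inv (pow_ne_zero k hus)).add
        ((hG s hs).const_mul (k:ℝ))).congr_deriv ?_
      obtain ⟨m, rfl⟩ := Nat.exists_eq_succ_of_ne_zero hk
      simp only [Nat.succ_eq_add_one, Nat.add_sub_cancel, Pi.pow_apply]
      field_simp
      ring) ht
  have hG0 : G 0 = 0 := by simpa using hGint 0 le_rfl
  simp only [hG0, mul_zero, add_zero] at hconst
  exact ⟨hpos t ht, by rw [← hGint t ht]; linarith⟩

theorem pow_eq_mul_rpow_of_inv_pow {k D : ℕ} (hk : k ≠ 0) {a v y : ℝ} (ha : 0 < a) (hv : 0 < v)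
    (h : a ^ k * (v ^ k)⁻¹ = y) : v ^ D = a ^ D * y ^ (-(D:ℝ) / (k:ℝ)) := by
  have hk' : (k:ℝ) ≠ 0 := Nat.cast_ne_zero.mpr hk
  have hy : y = (v / a) ^ (-(k:ℝ)) := by
    rw [← h, Real.rpow_neg (by positivity), Real.rpow_natCast, div_pow, inv_div, div_eq_mul_inv]
  rw [hy, ← Real.rpow_mul (by positivity), show -(k:ℝ) * (-(D:ℝ) / k) = D by field_simp, Real.rpow_natCast, div_pow,
    mul_div_cancel₀ _ (by positivity : a ^ D ≠ 0)]

theorem stmt4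
    (d N D : ℕ) (hd : 0 < d) (hN : 0 < N) (hD : 2 < D)
    (x : Fin N → Fin d → ℝ)
    (γ₂ : ℝ) (hγ₂pos : 0 < γ₂)
    (hγ₂ : IsGreatest {g : ℝ | ∃ v : Fin d → ℝ, (∑ i, (v i)^2) = 1 ∧ ∀ n, g ≤ ∑ i, x n i * v i} γ₂)
    (α : ℝ) (hα : 0 < α)
    (up um : ℝ → Fin d → ℝ)
    (hinit : ∀ i, up 0 i = α ∧ um 0 i = α)
    (w : ℝ → Fin d → ℝ)
    (hw : ∀ t i, w t i = (up t i)^D - (um t i)^D)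
    (hflowp : ∀ t, 0 ≤ t → ∀ i, HasDerivAt (fun s => up s i)
        (((D:ℝ)/(N:ℝ)) * (up t i)^(D-1) * ∑ n, Real.exp (-(∑ j, x n j * w t j)) * x n i) t)
    (hflowm : ∀ t, 0 ≤ t → ∀ i, HasDerivAt (fun s => um s i)
        (-(((D:ℝ)/(N:ℝ)) * (um t i)^(D-1) * ∑ n, Real.exp (-(∑ j, x n j * w t j)) * x n i)) t)
    (r : ℝ → Fin N → ℝ)
    (hr : ∀ t n, r t n = (1 / (N:ℝ)) * Real.exp (-(∑ i, x n i * w t i)))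
    :
    ∀ t : ℝ, 0 ≤ t → ∀ i : Fin d, ∀ z : ℝ,
      z = α^(D-2) * (D:ℝ) * ((D:ℝ)-2) * ∑ n, (∫ s in (0:ℝ)..t, r s n) * x n i →
      (-1 < z ∧ z < 1) ∧
      w t i = α^D * ((1 - z) ^ (-(D:ℝ)/((D:ℝ)-2)) - (1 + z) ^ (-(D:ℝ)/((D:ℝ)-2))) := by
  intro t ht i z hz
  obtain ⟨k, rfl⟩ : ∃ k, D = k + 2 := ⟨D - 2, by omega⟩
  have hk : k ≠ 0 := by omega
  have hupc : ∀ j, ContinuousOn (fun s => up s j) (Set.Ici 0) := fun j s hs =>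
    (hflowp s hs j).continuousAt.continuousWithinAt
  have humc : ∀ j, ContinuousOn (fun s => um s j) (Set.Ici 0) := fun j s hs =>
    (hflowm s hs j).continuousAt.continuousWithinAt
  have hrc : ∀ n, ContinuousOn (fun s => r s n) (Set.Ici 0) := fun n => by
    simp only [hr, hw]
    fun_prop
  set g : ℝ → ℝ := fun s => ((k + 2 : ℕ) : ℝ) * ∑ n, r s n * x n i with hg
  have hgc : ContinuousOn g (Set.Ici 0) := by fun_prop
  have hgr : ∀ s, ((k + 2 : ℕ) : ℝ) / (N:ℝ) * ∑ n, Real.exp (-(∑ j, x n j * w s j)) * x n i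
      = g s := fun s => by
    simp only [hg, hr, mul_assoc, ← Finset.mul_sum]
    ring
  have hgint : ∫ s in (0:ℝ)..t, g s
      = ((k + 2 : ℕ) : ℝ) * ∑ n, (∫ s in (0:ℝ)..t, r s n) * x n i := by
    have hint : ∀ n, IntervalIntegrable (fun s => r s n) volume 0 t := fun n =>
      ((hrc n).mono (by rw [Set.uIcc_of_le ht]; exact Set.Icc_subset_Ici_self)).intervalIntegrable
    rw [hg, intervalIntegral.integral_const_mul,
      intervalIntegral.integral_finsetSum fun n _ => (hint n).mul_const _]
    simp only [intervalIntegral.integral_mul_const]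
  have hz' : z = α ^ k * (k * ∫ s in (0:ℝ)..t, g s) := by
    rw [hz, hgint, Nat.add_sub_cancel]
    push_cast
    ring
  obtain ⟨hup, hupeq⟩ := bernoulli_solution (u := fun s => up s i) hk
    (by simpa only [(hinit i).1] using hα) hgc
    (fun s hs => by
      convert hflowp s hs i using 1
      rw [← hgr s, show k + 2 - 1 = k + 1 by omega]
      ring) ht
  obtain ⟨hum, humeq⟩ := bernoulli_solution (u := fun s => um s i) hk
    (by simpa only [(hinit i).2] using hα) hgc.neg
    (fun s hs => by
      convert hflowm s hs i using 1
      rw [Pi.neg_apply, ← hgr s, show k + 2 - 1 = k + 1 by omega]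
      ring) ht
  simp only [Pi.neg_apply, intervalIntegral.integral_neg, (hinit i).1, (hinit i).2]
    at hup hum hupeq humeq
  have hαk : α ^ k * (α ^ k)⁻¹ = 1 := mul_inv_cancel₀ (by positivity)
  have hplus : α ^ k * (up t i ^ k)⁻¹ = 1 - z := by
    rw [hupeq, hz', mul_sub, hαk]
  have hminus : α ^ k * (um t i ^ k)⁻¹ = 1 + z := by
    rw [humeq, hz', mul_sub, hαk]
    ring
  have h1 : 0 < 1 - z := hplus ▸ by positivity
  have h2 : 0 < 1 + z := hminus ▸ by positivity
  refine ⟨⟨by linarith, by linarith⟩, ?_⟩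
  rw [hw, pow_eq_mul_rpow_of_inv_pow hk hα hup hplus, pow_eq_mul_rpow_of_inv_pow hk hα hum hminus,
    show ((k + 2 : ℕ) : ℝ) - 2 = k by push_cast; ring]
  ring
end

section
/- Suppose D = 2 and the stopping accuracy satisfies log(1/ε(α)) = o(α²) as α → ∞. Then ŵ is the unique minimizer of ‖w‖₂ over w ∈ ℝ^d subject to x_nᵀw ≥ 1 for all n ∈ {1,…,N}. -/
open Real Finset Filter Topology MeasureTheory

theorem abs_sinh_le_abs_mul_cosh (y : ℝ) : |Real.sinh y| ≤ |y| * Real.cosh y := by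
  have key : ∀ z : ℝ, 0 ≤ z → Real.sinh z ≤ z * Real.cosh z := by
    intro z hz
    have hd : ∀ t : ℝ, HasDerivAt (fun s => s * Real.cosh s - Real.sinh s)
        (1 * Real.cosh t + t * Real.sinh t - Real.cosh t) t := fun t =>
      ((hasDerivAt_id t).mul (Real.hasDerivAt_cosh t)).sub (Real.hasDerivAt_sinh t)
    have hmono : MonotoneOn (fun s => s * Real.cosh s - Real.sinh s) (Set.Ici 0) := by
      refine monotoneOn_of_deriv_nonneg (convex_Ici 0)
        (fun t _ => (hd t).continuousAt.continuousWithinAt)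
        (fun t _ => (hd t).differentiableAt.differentiableWithinAt) fun t ht => ?_
      rw [interior_Ici] at ht
      rw [(hd t).deriv]
      have := mul_nonneg (le_of_lt ht) (Real.sinh_nonneg_iff.2 (le_of_lt ht))
      linarith
    have := hmono (Set.mem_Ici.2 le_rfl) (Set.mem_Ici.2 hz) hz
    simp only [zero_mul, Real.sinh_zero, sub_zero] at this
    linarith
  rw [Real.abs_sinh, ← Real.cosh_abs y]
  exact key _ (abs_nonneg y)

theorem mul_eq_sq_and_pos_of_flow {p m g : ℝ → ℝ} {a : ℝ} (ha : 0 < a)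
    (hp0 : p 0 = a) (hm0 : m 0 = a)
    (hp : ∀ t, 0 ≤ t → HasDerivAt p (2 * p t * g t) t)
    (hm : ∀ t, 0 ≤ t → HasDerivAt m (-(2 * m t * g t)) t) {t : ℝ} (ht : 0 ≤ t) :
    p t * m t = a ^ 2 ∧ 0 < p t := by
  have hprod : ∀ s, 0 ≤ s → p s * m s = a ^ 2 := by
    intro s hs
    have hd : ∀ r ∈ Set.Icc 0 s, HasDerivAt (fun r => p r * m r) 0 r := by
      intro r hr
      refine ((hp r hr.1).fun_mul (hm r hr.1)).congr_deriv ?_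
      ring
    have := constant_of_has_deriv_right_zero (f := fun r => p r * m r) (a := 0) (b := s)
      (fun r hr => (hd r hr).continuousAt.continuousWithinAt)
      (fun r hr => (hd r ⟨hr.1, hr.2.le⟩).hasDerivWithinAt) s ⟨hs, le_rfl⟩
    simp only [hp0, hm0] at this
    rw [this]; ring
  refine ⟨hprod t ht, ?_⟩
  by_contra! hneg
  have hcont : ContinuousOn p (Set.Icc 0 t) :=
    fun r hr => (hp r hr.1).continuousAt.continuousWithinAt
  obtain ⟨r, hr, hr0⟩ := intermediate_value_Icc' ht hcont ⟨hneg, by rw [hp0]; exact ha.le⟩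
  have := hprod r hr.1
  rw [hr0, zero_mul] at this
  exact (pow_pos ha 2).ne this

theorem hasDerivAt_log_div_two {p g : ℝ → ℝ} {a t : ℝ} (ha : 0 < a) (hpos : 0 < p t)
    (hp : HasDerivAt p (2 * p t * g t) t) :
    HasDerivAt (fun s => Real.log (p s / a) / 2) (g t) t := by
  have h := ((hp.div_const a).log (div_pos hpos ha).ne').div_const 2
  refine h.congr_deriv ?_
  field_simp

theorem sq_sub_sq_eq_sinh {p m a : ℝ} (ha : 0 < a) (hp : 0 < p) (h : p * m = a ^ 2) :
    p ^ 2 - m ^ 2 = 2 * a ^ 2 * Real.sinh (4 * (Real.log (p / a) / 2)) := by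
  have hm : m = a ^ 2 / p := by field_simp; linarith
  have h1 : Real.exp (4 * (Real.log (p / a) / 2)) = (p / a) ^ 2 := by
    rw [show 4 * (Real.log (p / a) / 2) = ((2 : ℕ) : ℝ) * Real.log (p / a) by push_cast; ring,
      Real.exp_nat_mul, Real.exp_log (div_pos hp ha)]
  rw [Real.sinh_eq, Real.exp_neg, h1, hm]
  field_simp

theorem mul_sum_le_sqrt_of_margin {ι κ : Type*} [Fintype ι] [Fintype κ] {x : κ → ι → ℝ}
    {v : ι → ℝ} {γ : ℝ} (hv : ∑ i, v i ^ 2 = 1) (hx : ∀ n, γ ≤ ∑ i, x n i * v i)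
    {r : κ → ℝ} (hr : ∀ n, 0 ≤ r n) :
    γ * ∑ n, r n ≤ √(∑ i, (∑ n, r n * x n i) ^ 2) := by
  have h1 : γ * ∑ n, r n ≤ ∑ i, (∑ n, r n * x n i) * v i := by
    calc γ * ∑ n, r n = ∑ n, r n * γ := by rw [mul_comm, Finset.sum_mul]
      _ ≤ ∑ n, r n * ∑ i, x n i * v i :=
        Finset.sum_le_sum fun n _ => mul_le_mul_of_nonneg_left (hx n) (hr n)
      _ = ∑ i, (∑ n, r n * x n i) * v i := by
        simp_rw [Finset.mul_sum, Finset.sum_mul]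
        rw [Finset.sum_comm]
        simp_rw [mul_assoc]
  have h2 := Real.sum_mul_le_sqrt_mul_sqrt Finset.univ (fun i => ∑ n, r n * x n i) v
  rw [hv, Real.sqrt_one, mul_one] at h2
  exact h1.trans h2

/-- Along the flow, `log (p / a) / 2` has Euclidean length at most `-log L / (8 a² γ)`. -/
theorem sum_sq_log_le_of_flow {ι κ : Type*} [Fintype ι] [Fintype κ] {x : κ → ι → ℝ}
    {v : ι → ℝ} {γ a : ℝ} (hγ : 0 < γ) (ha : 0 < a) (hv : ∑ i, v i ^ 2 = 1)
    (hx : ∀ n, γ ≤ ∑ i, x n i * v i)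
    {p m : ℝ → ι → ℝ} {r : ℝ → κ → ℝ} (hr : ∀ t n, 0 < r t n) (hr0 : ∑ n, r 0 n = 1)
    (hp0 : ∀ i, p 0 i = a) (hm0 : ∀ i, m 0 i = a)
    (hp : ∀ t, 0 ≤ t → ∀ i,
      HasDerivAt (fun s => p s i) (2 * p t i * ∑ n, r t n * x n i) t)
    (hm : ∀ t, 0 ≤ t → ∀ i,
      HasDerivAt (fun s => m s i) (-(2 * m t i * ∑ n, r t n * x n i)) t)
    (hL : ∀ t, 0 ≤ t → HasDerivAt (fun s => ∑ n, r s n)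
      (-∑ i, 4 * (p t i ^ 2 + m t i ^ 2) * (∑ n, r t n * x n i) ^ 2) t)
    {T : ℝ} (hT : 0 ≤ T) :
    √(∑ i, (Real.log (p T i / a) / 2) ^ 2) ≤ -Real.log (∑ n, r T n) / (8 * a ^ 2 * γ) := by
  have hne : Nonempty κ := by
    by_contra h
    rw [not_nonempty_iff] at h
    simp at hr0
  have hpm : ∀ t, 0 ≤ t → ∀ i, p t i * m t i = a ^ 2 ∧ 0 < p t i := fun t ht i =>
    mul_eq_sq_and_pos_of_flow (p := fun s => p s i) (m := fun s => m s i)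
      (g := fun s => ∑ n, r s n * x n i) ha (hp0 i) (hm0 i)
      (fun s hs => hp s hs i) (fun s hs => hm s hs i) ht
  have hLpos : ∀ t, 0 < ∑ n, r t n := fun t =>
    Finset.sum_pos (fun n _ => hr t n) Finset.univ_nonempty
  set q : ℝ → ι → ℝ := fun t i => Real.log (p t i / a) / 2 with hq
  have hqd : ∀ t, 0 ≤ t → ∀ i, HasDerivAt (fun s => q s i) (∑ n, r t n * x n i) t :=
    fun t ht i => hasDerivAt_log_div_two (p := fun s => p s i)
      (g := fun s => ∑ n, r s n * x n i) ha (hpm t ht i).2 (hp t ht i)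
  set Q := √(∑ i, q T i ^ 2) with hQ
  have hQ0 : 0 ≤ Q := Real.sqrt_nonneg _
  have hQsq : Q ^ 2 = ∑ i, q T i ^ 2 := Real.sq_sqrt (Finset.sum_nonneg fun i _ => sq_nonneg _)
  let F : ℝ → ℝ := fun t => Q * (-Real.log (∑ n, r t n) / (8 * a ^ 2 * γ)) - ∑ i, q T i * q t i
  have hF : ∀ t, 0 ≤ t → HasDerivAt F
      (Q * (-((-∑ i, 4 * (p t i ^ 2 + m t i ^ 2) * (∑ n, r t n * x n i) ^ 2) / ∑ n, r t n)
        / (8 * a ^ 2 * γ)) - ∑ i, q T i * ∑ n, r t n * x n i) t := fun t ht =>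
    ((((hL t ht).log (hLpos t).ne').neg.div_const _).const_mul Q).sub
      (HasDerivAt.fun_sum fun i _ => (hqd t ht i).const_mul _)
  have hmono : MonotoneOn F (Set.Icc 0 T) := by
    refine monotoneOn_of_deriv_nonneg (convex_Icc 0 T)
      (fun t ht => (hF t ht.1).continuousAt.continuousWithinAt)
      (fun t ht => (hF t (interior_subset ht).1).differentiableAt.differentiableWithinAt)
      fun t ht => ?_
    have ht0 : 0 ≤ t := (interior_subset ht).1
    rw [(hF t ht0).deriv, sub_nonneg]
    set G := √(∑ i, (∑ n, r t n * x n i) ^ 2) with hG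
    have hGsq : G ^ 2 = ∑ i, (∑ n, r t n * x n i) ^ 2 :=
      Real.sq_sqrt (Finset.sum_nonneg fun i _ => sq_nonneg _)
    have hGL : γ * ∑ n, r t n ≤ G := mul_sum_le_sqrt_of_margin hv hx fun n => (hr t n).le
    have hG0 : 0 ≤ G := Real.sqrt_nonneg _
    have hS : 8 * a ^ 2 * G ^ 2 ≤
        ∑ i, 4 * (p t i ^ 2 + m t i ^ 2) * (∑ n, r t n * x n i) ^ 2 := by
      rw [hGsq, Finset.mul_sum]
      refine Finset.sum_le_sum fun i _ => mul_le_mul_of_nonneg_right ?_ (sq_nonneg _)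
      have := (hpm t ht0 i).1
      nlinarith [sq_nonneg (p t i - m t i)]
    refine (Real.sum_mul_le_sqrt_mul_sqrt Finset.univ (q T)
      (fun i => ∑ n, r t n * x n i)).trans ?_
    refine mul_le_mul_of_nonneg_left ?_ hQ0
    rw [neg_div (∑ n, r t n), neg_neg, div_div, le_div_iff₀ (mul_pos (hLpos t) (by positivity))]
    refine le_trans ?_ hS
    calc G * ((∑ n, r t n) * (8 * a ^ 2 * γ)) = 8 * a ^ 2 * (G * (γ * ∑ n, r t n)) := by ring
      _ ≤ 8 * a ^ 2 * (G * G) := by gcongr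
      _ = 8 * a ^ 2 * G ^ 2 := by ring
  have h0T := hmono ⟨le_rfl, hT⟩ ⟨hT, le_rfl⟩ hT
  have hF0 : F 0 = 0 := by simp [F, hr0, hq, hp0, ha.ne']
  rw [hF0] at h0T
  have hFT : Q ^ 2 ≤ Q * (-Real.log (∑ n, r T n) / (8 * a ^ 2 * γ)) := by
    have : ∑ i, q T i * q T i = Q ^ 2 := by rw [hQsq]; simp_rw [sq]
    simp only [F, this] at h0T
    linarith
  rcases hQ0.eq_or_lt with h | h
  · rw [← h]
    have hanti : ∑ n, r T n ≤ ∑ n, r 0 n := by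
      have : AntitoneOn (fun s => ∑ n, r s n) (Set.Icc 0 T) := by
        refine antitoneOn_of_deriv_nonpos (convex_Icc 0 T)
          (fun t ht => (hL t ht.1).continuousAt.continuousWithinAt)
          (fun t ht => (hL t (interior_subset ht).1).differentiableAt.differentiableWithinAt)
          fun t ht => ?_
        rw [(hL t (interior_subset ht).1).deriv, neg_nonpos]
        exact Finset.sum_nonneg fun i _ => by positivity
      exact this ⟨le_rfl, hT⟩ ⟨hT, le_rfl⟩ hT
    have := Real.log_nonpos (hLpos T).le (hanti.trans hr0.le)
    exact div_nonneg (by linarith) (by positivity)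
  · exact le_of_mul_le_mul_left (by rw [← sq]; exact hFT) h

theorem sum_sq_sub_sq_le_of_flow {ι κ : Type*} [Fintype ι] [Fintype κ] {x : κ → ι → ℝ}
    {v : ι → ℝ} {γ a : ℝ} (hγ : 0 < γ) (ha : 0 < a) (hv : ∑ i, v i ^ 2 = 1)
    (hx : ∀ n, γ ≤ ∑ i, x n i * v i)
    {p m : ℝ → ι → ℝ} {r : ℝ → κ → ℝ} (hr : ∀ t n, 0 < r t n) (hr0 : ∑ n, r 0 n = 1)
    (hp0 : ∀ i, p 0 i = a) (hm0 : ∀ i, m 0 i = a)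
    (hp : ∀ t, 0 ≤ t → ∀ i,
      HasDerivAt (fun s => p s i) (2 * p t i * ∑ n, r t n * x n i) t)
    (hm : ∀ t, 0 ≤ t → ∀ i,
      HasDerivAt (fun s => m s i) (-(2 * m t i * ∑ n, r t n * x n i)) t)
    (hL : ∀ t, 0 ≤ t → HasDerivAt (fun s => ∑ n, r s n)
      (-∑ i, 4 * (p t i ^ 2 + m t i ^ 2) * (∑ n, r t n * x n i) ^ 2) t)
    {T : ℝ} (hT : 0 ≤ T) :
    ∑ i, (p T i ^ 2 - m T i ^ 2) ^ 2 ≤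
      (Real.cosh (-Real.log (∑ n, r T n) / a ^ 2 / (2 * γ)) *
        (-Real.log (∑ n, r T n)) / γ) ^ 2 := by
  have hQ := sum_sq_log_le_of_flow hγ ha hv hx hr hr0 hp0 hm0 hp hm hL hT
  set l := -Real.log (∑ n, r T n)
  set B := l / (8 * a ^ 2 * γ) with hB
  have hB0 : 0 ≤ B := (Real.sqrt_nonneg _).trans hQ
  have hBsq := (Real.sqrt_le_left hB0).1 hQ
  have h4B : l / a ^ 2 / (2 * γ) = 4 * B := by rw [hB]; field_simp; ring
  have hl : l = 8 * a ^ 2 * γ * B := by rw [hB]; field_simp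
  rw [h4B]
  calc ∑ i, (p T i ^ 2 - m T i ^ 2) ^ 2
      ≤ ∑ i, (8 * a ^ 2 * Real.cosh (4 * B)) ^ 2 * (Real.log (p T i / a) / 2) ^ 2 := by
        refine Finset.sum_le_sum fun i _ => ?_
        obtain ⟨hpm, hpos⟩ := mul_eq_sq_and_pos_of_flow (p := fun s => p s i)
          (m := fun s => m s i) (g := fun s => ∑ n, r s n * x n i) ha (hp0 i) (hm0 i)
          (fun s hs => hp s hs i) (fun s hs => hm s hs i) hT
        rw [sq_sub_sq_eq_sinh ha hpos hpm]
        set y := Real.log (p T i / a) / 2 with hy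
        have hyB : |y| ≤ B := by
          refine abs_le_of_sq_le_sq ?_ hB0
          exact (Finset.single_le_sum (f := fun i => (Real.log (p T i / a) / 2) ^ 2)
            (fun i _ => sq_nonneg _) (Finset.mem_univ i)).trans hBsq
        have hc : Real.cosh (4 * y) ≤ Real.cosh (4 * B) := by
          rw [Real.cosh_le_cosh, abs_mul, abs_mul, abs_of_nonneg hB0]
          gcongr
        have hs : |Real.sinh (4 * y)| ≤ 4 * |y| * Real.cosh (4 * B) := by
          refine (abs_sinh_le_abs_mul_cosh _).trans ?_
          rw [abs_mul, abs_of_pos (by norm_num : (0 : ℝ) < 4)]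
          gcongr
        rw [← mul_pow, sq_le_sq, abs_mul, abs_mul _ y, abs_of_pos (by positivity : 0 < 2 * a ^ 2),
          abs_of_pos (by have := Real.cosh_pos (4 * B); positivity :
            0 < 8 * a ^ 2 * Real.cosh (4 * B))]
        calc 2 * a ^ 2 * |Real.sinh (4 * y)|
            ≤ 2 * a ^ 2 * (4 * |y| * Real.cosh (4 * B)) := by gcongr
          _ = 8 * a ^ 2 * Real.cosh (4 * B) * |y| := by ring
    _ ≤ (8 * a ^ 2 * Real.cosh (4 * B)) ^ 2 * B ^ 2 := by
        rw [← Finset.mul_sum]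
        gcongr
    _ = (Real.cosh (4 * B) * l / γ) ^ 2 := by
        rw [hl]; field_simp

theorem hasDerivAt_sum_exp_of_flow {ι κ : Type*} [Fintype ι] [Fintype κ] {x : κ → ι → ℝ}
    {p m : ℝ → ι → ℝ} {c t : ℝ}
    (hp : ∀ i, HasDerivAt (fun s => p s i) (2 * p t i *
      ∑ n, c * Real.exp (-∑ j, x n j * (p t j ^ 2 - m t j ^ 2)) * x n i) t)
    (hm : ∀ i, HasDerivAt (fun s => m s i) (-(2 * m t i *
      ∑ n, c * Real.exp (-∑ j, x n j * (p t j ^ 2 - m t j ^ 2)) * x n i)) t) :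
    HasDerivAt (fun s => ∑ n, c * Real.exp (-∑ j, x n j * (p s j ^ 2 - m s j ^ 2)))
      (-∑ i, 4 * (p t i ^ 2 + m t i ^ 2) *
        (∑ n, c * Real.exp (-∑ j, x n j * (p t j ^ 2 - m t j ^ 2)) * x n i) ^ 2) t := by
  set r : κ → ℝ := fun n => c * Real.exp (-∑ j, x n j * (p t j ^ 2 - m t j ^ 2)) with hr
  have h := HasDerivAt.fun_sum (u := Finset.univ) fun (n : κ) _ =>
    ((HasDerivAt.fun_sum (u := Finset.univ) fun (i : ι) _ =>
      ((((hp i).fun_pow 2).sub ((hm i).fun_pow 2)).const_mul (x n i))).neg.exp.const_mul c)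
  refine h.congr_deriv ?_
  calc _ = ∑ n, -∑ i, r n * (x n i * (4 * (p t i ^ 2 + m t i ^ 2) * ∑ k, r k * x k i)) := by
        refine Finset.sum_congr rfl fun n _ => ?_
        rw [← Finset.mul_sum, ← mul_neg, ← mul_assoc]
        congr 2
        refine Finset.sum_congr rfl fun i _ => ?_
        push_cast
        ring
    _ = _ := by
        rw [Finset.sum_neg_distrib, Finset.sum_comm]
        congr 1
        refine Finset.sum_congr rfl fun i _ => ?_
        simp_rw [← mul_assoc (r _) (x _ i)]
        rw [← Finset.sum_mul]
        ring

theorem neg_log_sub_log_card_le {κ : Type*} [Fintype κ] {f : κ → ℝ} (k : κ) {N : ℝ}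
    (hN : 0 < N) :
    -Real.log (1 / N * ∑ n, Real.exp (-f n)) - Real.log N ≤ f k := by
  have h1 : Real.exp (-f k) ≤ ∑ n, Real.exp (-f n) :=
    Finset.single_le_sum (f := fun n => Real.exp (-f n)) (fun n _ => (Real.exp_pos _).le)
      (Finset.mem_univ k)
  have hpos := (Real.exp_pos (-f k)).trans_le h1
  have h2 := Real.log_le_log (Real.exp_pos _) h1
  rw [Real.log_exp] at h2
  rw [Real.log_mul (by positivity) hpos.ne', one_div, Real.log_inv]
  linarith

theorem sum_sq_lt_of_isGreatest_margin {ι κ : Type*} [Fintype ι] [Nonempty κ]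
    {x : κ → ι → ℝ} {γ : ℝ} (hγ : 0 < γ)
    (hmax : γ ∈ upperBounds {g : ℝ | ∃ v : ι → ℝ, ∑ i, v i ^ 2 = 1 ∧ ∀ n, g ≤ ∑ i, x n i * v i})
    {u v : ι → ℝ} (hu : ∀ n, 1 ≤ ∑ i, x n i * u i) (hv : ∀ n, 1 ≤ ∑ i, x n i * v i)
    (hun : ∑ i, u i ^ 2 ≤ (1 / γ) ^ 2) (hne : v ≠ u) :
    ∑ i, u i ^ 2 < ∑ i, v i ^ 2 := by
  have key : ∀ z : ι → ℝ, (∀ n, 1 ≤ ∑ i, x n i * z i) → (1 / γ) ^ 2 ≤ ∑ i, z i ^ 2 := by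
    intro z hz
    set S := √(∑ i, z i ^ 2) with hS
    have hSsq : S ^ 2 = ∑ i, z i ^ 2 := Real.sq_sqrt (Finset.sum_nonneg fun i _ => sq_nonneg _)
    have hSpos : 0 < S := by
      refine (Real.sqrt_nonneg _).lt_of_ne fun h => ?_
      rw [← hS] at h
      have h0 : ∑ i, z i ^ 2 = 0 := by rw [← hSsq, ← h]; norm_num
      rw [Finset.sum_eq_zero_iff_of_nonneg fun i _ => sq_nonneg _] at h0
      have hz0 : ∀ i, z i = 0 := fun i => by simpa using h0 i (Finset.mem_univ i)
      have := hz (Classical.arbitrary κ)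
      simp only [hz0, mul_zero, Finset.sum_const_zero] at this
      linarith
    have hle : 1 / S ≤ γ := by
      refine hmax ⟨fun i => z i / S, ?_, fun n => ?_⟩
      · simp_rw [div_pow]
        rw [← Finset.sum_div, hSsq, div_self]
        rw [← hSsq]; positivity
      · simp_rw [← mul_div_assoc]
        rw [← Finset.sum_div]
        exact div_le_div_of_nonneg_right (hz n) hSpos.le
    rw [← hSsq]
    have : 1 / γ ≤ S := by
      rw [div_le_iff₀ hγ]
      rw [div_le_iff₀ hSpos] at hle
      linarith
    gcongr
  by_contra! hle
  have hmid := key (fun i => (u i + v i) / 2) fun n => by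
    have h : ∑ i, x n i * ((u i + v i) / 2) = (∑ i, x n i * u i + ∑ i, x n i * v i) / 2 := by
      rw [← Finset.sum_add_distrib, Finset.sum_div]
      exact Finset.sum_congr rfl fun i _ => by ring
    linarith [hu n, hv n]
  have hpar : ∑ i, ((u i + v i) / 2) ^ 2 + (∑ i, (v i - u i) ^ 2) / 4 =
      (∑ i, u i ^ 2 + ∑ i, v i ^ 2) / 2 := by
    rw [← Finset.sum_add_distrib, Finset.sum_div, Finset.sum_div, ← Finset.sum_add_distrib]
    exact Finset.sum_congr rfl fun i _ => by ring
  have hdpos : 0 < ∑ i, (v i - u i) ^ 2 := by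
    obtain ⟨i, hi⟩ := Function.ne_iff.1 hne
    exact Finset.sum_pos' (fun i _ => sq_nonneg _)
      ⟨i, Finset.mem_univ i, by have := sub_ne_zero.2 hi; positivity⟩
  linarith

theorem stmt7
    (d N D : ℕ) (hd : 0 < d) (hN : 0 < N) (hD : 2 ≤ D) (hD2 : D = 2)
    (x : Fin N → Fin d → ℝ)
    (γ₂ : ℝ) (hγ₂pos : 0 < γ₂)
    (hγ₂ : IsGreatest {g : ℝ | ∃ v : Fin d → ℝ, (∑ i, (v i)^2) = 1 ∧ ∀ n, g ≤ ∑ i, x n i * v i} γ₂)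
    (up um : ℝ → ℝ → Fin d → ℝ)
    (hinit : ∀ a : ℝ, 0 < a → ∀ i, up a 0 i = a ∧ um a 0 i = a)
    (w : ℝ → ℝ → Fin d → ℝ)
    (hw : ∀ a t i, w a t i = (up a t i)^D - (um a t i)^D)
    (Lf : ℝ → ℝ → ℝ)
    (hLf : ∀ a t, Lf a t = (1 / (N:ℝ)) * ∑ n, Real.exp (-(∑ i, x n i * w a t i)))
    (hflowp : ∀ a : ℝ, 0 < a → ∀ t, 0 ≤ t → ∀ i, HasDerivAt (fun s => up a s i)
        (((D:ℝ)/(N:ℝ)) * (up a t i)^(D-1) * ∑ n, Real.exp (-(∑ j, x n j * w a t j)) * x n i) t)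
    (hflowm : ∀ a : ℝ, 0 < a → ∀ t, 0 ≤ t → ∀ i, HasDerivAt (fun s => um a s i)
        (-(((D:ℝ)/(N:ℝ)) * (um a t i)^(D-1) * ∑ n, Real.exp (-(∑ j, x n j * w a t j)) * x n i)) t)
    (ε : ℝ → ℝ)
    (hεanti : StrictAntiOn ε (Set.Ioi (0:ℝ)))
    (hεrange : ∀ a : ℝ, 0 < a → 0 < ε a ∧ ε a ≤ 1)
    (hεlim : Filter.Tendsto ε Filter.atTop (nhds 0))
    (T : ℝ → ℝ)
    (hT : ∀ a : ℝ, 0 < a → 0 ≤ T a ∧ Lf a (T a) = ε a)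
    (γm : ℝ → ℝ → ℝ)
    (hγm : ∀ a t, IsLeast {g : ℝ | ∃ n : Fin N, g = ∑ i, x n i * w a t i} (γm a t))
    (what : Fin d → ℝ)
    (hlim : Filter.Tendsto (fun a => fun i => w a (T a) i / γm a (T a)) Filter.atTop (nhds what))
    (hsmall : Filter.Tendsto (fun a => Real.log (1 / ε a) / a^2) Filter.atTop (nhds 0))
    :
    (∀ n, 1 ≤ ∑ i, x n i * what i) ∧
    ∀ v : Fin d → ℝ, (∀ n, 1 ≤ ∑ i, x n i * v i) → v ≠ what →
      (∑ i, (what i)^2) < ∑ i, (v i)^2 := by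
  subst hD2
  have hNpos : (0 : ℝ) < N := Nat.cast_pos.2 hN
  have : Nonempty (Fin N) := ⟨⟨0, hN⟩⟩
  obtain ⟨⟨v₀, hv₀, hxv₀⟩, hmax⟩ := hγ₂
  set l : ℝ → ℝ := fun a => -Real.log (ε a) with hl
  have hltop : Tendsto l atTop atTop := by
    refine tendsto_neg_atBot_atTop.comp (Real.tendsto_log_nhdsGT_zero.comp ?_)
    exact tendsto_nhdsWithin_iff.2 ⟨hεlim, (eventually_gt_atTop 0).mono fun a ha =>
      (hεrange a ha).1⟩
  have hlsmall : Tendsto (fun a => l a / a ^ 2) atTop (𝓝 0) := by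
    simpa only [hl, one_div, Real.log_inv] using hsmall
  have hγl : ∀ a, 0 < a → l a - Real.log N ≤ γm a (T a) := by
    intro a ha
    obtain ⟨k, hk⟩ := (hγm a (T a)).1
    have := neg_log_sub_log_card_le (f := fun n => ∑ i, x n i * w a (T a) i) k hNpos
    rw [← hLf, (hT a ha).2] at this
    rw [hk]
    exact this
  have hbound : ∀ a, 0 < a → ∑ i, w a (T a) i ^ 2 ≤
      (Real.cosh (l a / a ^ 2 / (2 * γ₂)) * l a / γ₂) ^ 2 := by
    intro a ha
    let r : ℝ → Fin N → ℝ := fun t n =>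
      1 / (N : ℝ) * Real.exp (-∑ j, x n j * (up a t j ^ 2 - um a t j ^ 2))
    have hrL : ∀ t, ∑ n, r t n = Lf a t := by
      intro t
      simp only [r, hLf, hw, Finset.mul_sum]
    have hp : ∀ t, 0 ≤ t → ∀ i, HasDerivAt (fun s => up a s i)
        (2 * up a t i * ∑ n, r t n * x n i) t := by
      intro t ht i
      refine (hflowp a ha t ht i).congr_deriv ?_
      simp only [r, hw, Finset.mul_sum]
      refine Finset.sum_congr rfl fun n _ => ?_
      push_cast
      ring
    have hm : ∀ t, 0 ≤ t → ∀ i, HasDerivAt (fun s => um a s i)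
        (-(2 * um a t i * ∑ n, r t n * x n i)) t := by
      intro t ht i
      refine (hflowm a ha t ht i).congr_deriv ?_
      simp only [r, hw, Finset.mul_sum]
      congr 1
      refine Finset.sum_congr rfl fun n _ => ?_
      push_cast
      ring
    have hr0 : ∑ n, r 0 n = 1 := by
      simp [r, (hinit a ha _).1, (hinit a ha _).2, hNpos.ne']
    have h := sum_sq_sub_sq_le_of_flow (r := r) hγ₂pos ha hv₀ hxv₀
      (fun t n => by positivity) hr0 (fun i => (hinit a ha i).1) (fun i => (hinit a ha i).2)
      hp hm (fun t ht => hasDerivAt_sum_exp_of_flow (hp t ht) (hm t ht)) (hT a ha).1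
    simpa only [hrL, (hT a ha).2, ← hw] using h
  have hγpos : ∀ᶠ a in atTop, 0 < a ∧ 0 < l a - Real.log N :=
    (eventually_gt_atTop 0).and ((hltop.eventually_gt_atTop (Real.log N)).mono
      fun a h => sub_pos.2 h)
  have hcoord : ∀ i, Tendsto (fun a => w a (T a) i / γm a (T a)) atTop (𝓝 (what i)) :=
    tendsto_pi_nhds.1 hlim
  have hfeas : ∀ n, 1 ≤ ∑ i, x n i * what i := by
    intro n
    refine ge_of_tendsto (tendsto_finsetSum Finset.univ fun i _ =>
      (hcoord i).const_mul (x n i)) ?_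
    filter_upwards [hγpos] with a ha
    have hpos := ha.2.trans_le (hγl a ha.1)
    simp_rw [← mul_div_assoc]
    rw [← Finset.sum_div, le_div_iff₀ hpos, one_mul]
    exact (hγm a (T a)).2 ⟨n, rfl⟩
  have hratio : Tendsto (fun a => l a / (l a - Real.log N)) atTop (𝓝 1) := by
    have h0 : Tendsto (fun a => Real.log N / (l a - Real.log N)) atTop (𝓝 0) :=
      tendsto_const_nhds.div_atTop (tendsto_atTop_add_const_right _ (-Real.log N) hltop)
    have h1 := h0.const_add 1
    rw [add_zero] at h1
    refine h1.congr' ?_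
    filter_upwards [hγpos] with a ha
    have := ha.2.ne'
    field_simp
    ring
  have hcosh : Tendsto (fun a => Real.cosh (l a / a ^ 2 / (2 * γ₂))) atTop (𝓝 1) := by
    have h := (Real.continuous_cosh.tendsto _).comp (hlsmall.div_const (2 * γ₂))
    simpa [Function.comp_def] using h
  have hnorm : ∑ i, what i ^ 2 ≤ (1 / γ₂) ^ 2 := by
    have hlim' : Tendsto (fun a => (Real.cosh (l a / a ^ 2 / (2 * γ₂)) *
        (l a / (l a - Real.log N)) / γ₂) ^ 2) atTop (𝓝 ((1 / γ₂) ^ 2)) := by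
      simpa using ((hcosh.mul hratio).div_const γ₂).pow 2
    refine le_of_tendsto_of_tendsto (tendsto_finsetSum Finset.univ fun i _ =>
      (hcoord i).pow 2) hlim' ?_
    filter_upwards [hγpos] with a ha
    have hle := hγl a ha.1
    simp_rw [div_pow (w a (T a) _)]
    rw [← Finset.sum_div]
    calc (∑ i, w a (T a) i ^ 2) / γm a (T a) ^ 2
        ≤ (Real.cosh (l a / a ^ 2 / (2 * γ₂)) * l a / γ₂) ^ 2 / (l a - Real.log N) ^ 2 :=
          div_le_div₀ (sq_nonneg _) (hbound a ha.1) (pow_pos ha.2 2)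
            (pow_le_pow_left₀ ha.2.le hle 2)
      _ = _ := by
          rw [← div_pow]
          congr 1
          field_simp
  exact ⟨hfeas, fun v hv hne => sum_sq_lt_of_isGreatest_margin hγ₂pos hmax hfeas hv hnorm hne⟩
end

section
/- Suppose D > 2 and the stopping accuracy satisfies log(1/ε(α)) = o(α^D) as α → ∞. Then ŵ is the unique minimizer of ‖w‖₂ over w ∈ ℝ^d subject to x_nᵀw ≥ 1 for all n ∈ {1,…,N}. -/
open Real Finset Filter Topology MeasureTheory

/-- The exponential loss of the linear predictor `v`. -/
noncomputable def expLoss {d N : ℕ} (x : Fin N → Fin d → ℝ) (v : Fin d → ℝ) : ℝ :=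
  (1 / (N : ℝ)) * ∑ n, Real.exp (-(∑ i, x n i * v i))

/-- The negative gradient of `expLoss`. -/
noncomputable def negGrad {d N : ℕ} (x : Fin N → Fin d → ℝ) (v : Fin d → ℝ) :
    EuclideanSpace ℝ (Fin d) :=
  WithLp.toLp 2 fun i => (1 / (N : ℝ)) * ∑ n, Real.exp (-(∑ j, x n j * v j)) * x n i

/-- The predictor of a diagonal linear network of depth `D`. -/
def diagPredictor {d : ℕ} (D : ℕ) (p m : Fin d → ℝ) : Fin d → ℝ :=
  fun i => p i ^ D - m i ^ D

/-- Gradient flow of the exponential loss of a diagonal linear network, started at `α • 𝟙`. -/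
structure IsDiagFlow {d N : ℕ} (D : ℕ) (x : Fin N → Fin d → ℝ) (α : ℝ)
    (p m : ℝ → Fin d → ℝ) : Prop where
  init_pos : ∀ i, p 0 i = α
  init_neg : ∀ i, m 0 i = α
  deriv_pos : ∀ t, 0 ≤ t → ∀ i, HasDerivAt (fun s => p s i)
    (D * p t i ^ (D - 1) * negGrad x (diagPredictor D (p t) (m t)) i) t
  deriv_neg : ∀ t, 0 ≤ t → ∀ i, HasDerivAt (fun s => m s i)
    (-(D * m t i ^ (D - 1) * negGrad x (diagPredictor D (p t) (m t)) i)) t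

section ExpLoss

variable {d N : ℕ} {x : Fin N → Fin d → ℝ}

lemma expLoss_pos (hN : 0 < N) (v : Fin d → ℝ) : 0 < expLoss x v := by
  have : Nonempty (Fin N) := ⟨⟨0, hN⟩⟩
  have : (0 : ℝ) < N := by exact_mod_cast hN
  unfold expLoss
  positivity

lemma mul_expLoss_le_norm_negGrad {γ : ℝ} {v : Fin d → ℝ} (hv : ∑ i, v i ^ 2 = 1)
    (hγ : ∀ n, γ ≤ ∑ i, x n i * v i) (u : Fin d → ℝ) :
    γ * expLoss x u ≤ ‖negGrad x u‖ := by
  have hnorm : ‖WithLp.toLp 2 v‖ = 1 := by simp [EuclideanSpace.norm_eq, hv]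
  have hinner : inner ℝ (WithLp.toLp 2 v) (negGrad x u)
      = (1 / (N : ℝ)) * ∑ n, Real.exp (-(∑ j, x n j * u j)) * ∑ i, x n i * v i := by
    simp only [negGrad, PiLp.inner_apply, RCLike.inner_apply, conj_trivial, mul_sum, sum_mul]
    rw [sum_comm]
    exact sum_congr rfl fun n _ => sum_congr rfl fun i _ => by ring
  calc γ * expLoss x u
      = (1 / (N : ℝ)) * ∑ n, Real.exp (-(∑ j, x n j * u j)) * γ := by
        rw [expLoss, ← sum_mul]; ring
    _ ≤ inner ℝ (WithLp.toLp 2 v) (negGrad x u) := by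
        rw [hinner]
        gcongr with n
        exact hγ n
    _ ≤ ‖WithLp.toLp 2 v‖ * ‖negGrad x u‖ := real_inner_le_norm _ _
    _ = ‖negGrad x u‖ := by rw [hnorm, one_mul]

lemma hasDerivAt_expLoss {w : ℝ → Fin d → ℝ} {w' : Fin d → ℝ} {t : ℝ}
    (hw : ∀ i, HasDerivAt (fun s => w s i) (w' i) t) :
    HasDerivAt (fun s => expLoss x (w s)) (-∑ i, negGrad x (w t) i * w' i) t := by
  have h := (HasDerivAt.fun_sum fun (n : Fin N) (_ : n ∈ univ) =>
    (HasDerivAt.fun_sum fun (i : Fin d) (_ : i ∈ univ) =>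
      (hw i).const_mul (x n i)).neg.exp).const_mul (1 / (N : ℝ))
  refine h.congr_deriv ?_
  simp only [negGrad, mul_sum, sum_mul, mul_neg, sum_neg_distrib]
  rw [sum_comm]
  refine congrArg _ (sum_congr rfl fun n _ => sum_congr rfl fun i _ => ?_)
  simp only [Pi.neg_apply]
  ring

lemma neg_log_expLoss_le {γ : ℝ} {v : Fin d → ℝ} (hN : 0 < N)
    (hγ : ∃ n, γ = ∑ i, x n i * v i) :
    -Real.log (expLoss x v) ≤ γ + Real.log N := by
  obtain ⟨n, rfl⟩ := hγ
  have hN' : (0 : ℝ) < N := by exact_mod_cast hN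
  have hle : (1 / (N : ℝ)) * Real.exp (-(∑ i, x n i * v i)) ≤ expLoss x v := by
    unfold expLoss
    gcongr
    exact single_le_sum (f := fun n => Real.exp (-(∑ i, x n i * v i)))
      (fun _ _ => (Real.exp_pos _).le) (mem_univ n)
  have h := Real.log_le_log (by positivity) hle
  rw [Real.log_mul (by positivity) (by positivity), Real.log_exp, one_div, Real.log_inv] at h
  linarith

end ExpLoss

lemma norm_toLp_mul_le {d : ℕ} {c : Fin d → ℝ} {M : ℝ} (hM : 0 ≤ M) (hc : ∀ i, |c i| ≤ M)
    (h : EuclideanSpace ℝ (Fin d)) :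
    ‖(WithLp.toLp 2 fun i => c i * h i : EuclideanSpace ℝ (Fin d))‖ ≤ M * ‖h‖ := by
  refine abs_le_of_sq_le_sq' ?_ (by positivity) |>.2
  rw [mul_pow, EuclideanSpace.real_norm_sq_eq, EuclideanSpace.real_norm_sq_eq, mul_sum]
  gcongr with i
  rw [mul_pow]
  refine mul_le_mul_of_nonneg_right ?_ (sq_nonneg _)
  exact sq_le_sq' (abs_le.1 (hc i)).1 (abs_le.1 (hc i)).2

lemma pow_bounds_of_abs_sub_lt {α δ u : ℝ} (hα : 0 < α) (hδ1 : δ < 1) (hu : |u - α| < δ * α)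
    (k : ℕ) : ((1 - δ) * α) ^ k ≤ u ^ k ∧ |u ^ k| ≤ ((1 + δ) * α) ^ k := by
  rw [abs_lt] at hu
  have h1δ : 0 < 1 - δ := by linarith
  have hu0 : (1 - δ) * α ≤ u := by linarith
  have hu1 : 0 ≤ u := le_trans (by positivity) hu0
  refine ⟨by gcongr, ?_⟩
  rw [abs_of_nonneg (by positivity)]
  gcongr
  linarith

/-- Continuity induction: a bound that improves itself holds on the whole interval. -/
lemma forall_lt_of_bootstrap {f : ℝ → ℝ} {T δ : ℝ} (hf : ContinuousOn f (Set.Icc 0 T))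
    (h : ∀ t ∈ Set.Icc 0 T, (∀ s ∈ Set.Ico 0 t, f s < δ) → f t < δ) :
    ∀ t ∈ Set.Icc 0 T, f t < δ := by
  by_contra! hbad
  obtain ⟨t, ht, hft⟩ := hbad
  have hclosed : IsClosed (Set.Icc 0 T ∩ f ⁻¹' Set.Ici δ) :=
    hf.preimage_isClosed_of_isClosed isClosed_Icc isClosed_Ici
  obtain ⟨t₀, ht₀, hleast⟩ :=
    (isCompact_Icc.of_isClosed_subset hclosed Set.inter_subset_left).exists_isLeast ⟨t, ht, hft⟩
  refine (h t₀ ht₀.1 fun s hs => ?_).not_ge ht₀.2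
  by_contra! hs'
  exact hs.2.not_ge (hleast ⟨⟨hs.1, hs.2.le.trans ht₀.1.2⟩, hs'⟩)

namespace IsDiagFlow

variable {d N D : ℕ} {x : Fin N → Fin d → ℝ} {α : ℝ} {p m : ℝ → Fin d → ℝ}

lemma hasDerivAt_diagPredictor (hflow : IsDiagFlow D x α p m) {t : ℝ} (ht : 0 ≤ t) (i : Fin d) :
    HasDerivAt (fun s => diagPredictor D (p s) (m s) i)
      ((D : ℝ) ^ 2 * ((p t i ^ (D - 1)) ^ 2 + (m t i ^ (D - 1)) ^ 2) *
        negGrad x (diagPredictor D (p t) (m t)) i) t := by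
  have h := ((hflow.deriv_pos t ht i).fun_pow D).fun_sub ((hflow.deriv_neg t ht i).fun_pow D)
  exact h.congr_deriv (by ring)

lemma hasDerivAt_neg_log_expLoss (hflow : IsDiagFlow D x α p m) (hN : 0 < N) {t : ℝ}
    (ht : 0 ≤ t) :
    HasDerivAt (fun s => -Real.log (expLoss x (diagPredictor D (p s) (m s))))
      ((∑ i, (D : ℝ) ^ 2 * ((p t i ^ (D - 1)) ^ 2 + (m t i ^ (D - 1)) ^ 2) *
        negGrad x (diagPredictor D (p t) (m t)) i ^ 2) /
          expLoss x (diagPredictor D (p t) (m t))) t := by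
  have h := ((hasDerivAt_expLoss (x := x) (hflow.hasDerivAt_diagPredictor ht)).log
    (expLoss_pos hN _).ne').fun_neg
  refine h.congr_deriv ?_
  rw [neg_div, neg_neg]
  exact congrArg (· / _) (sum_congr rfl fun i _ => by ring)

lemma neg_log_expLoss_zero (hflow : IsDiagFlow D x α p m) (hN : 0 < N) :
    -Real.log (expLoss x (diagPredictor D (p 0) (m 0))) = 0 := by
  have : (N : ℝ) ≠ 0 := by exact_mod_cast hN.ne'
  simp [expLoss, diagPredictor, hflow.init_pos, hflow.init_neg, this]

lemma monotoneOn_neg_log_expLoss (hflow : IsDiagFlow D x α p m) (hN : 0 < N) :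
    MonotoneOn (fun s => -Real.log (expLoss x (diagPredictor D (p s) (m s)))) (Set.Ici 0) := by
  have hderiv := fun t ht => hflow.hasDerivAt_neg_log_expLoss hN (t := t) ht
  refine monotoneOn_of_hasDerivWithinAt_nonneg (convex_Ici 0)
    (fun t ht => (hderiv t ht).continuousAt.continuousWithinAt)
    (fun t ht => (hderiv t (interior_subset ht)).hasDerivWithinAt) fun t _ => ?_
  have := expLoss_pos (x := x) hN (diagPredictor D (p t) (m t))
  positivity

/-- If the powers of the weights are at least `A`, the smoothed margin grows at a rate
proportional to the size of the gradient. -/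
lemma mul_norm_negGrad_le (hN : 0 < N) {γ : ℝ} {v : Fin d → ℝ} (hv : ∑ i, v i ^ 2 = 1)
    (hγ : ∀ n, γ ≤ ∑ i, x n i * v i) {A : ℝ} (hA : 0 ≤ A) {t : ℝ}
    (hp : ∀ i, A ≤ p t i ^ (D - 1)) (hm : ∀ i, A ≤ m t i ^ (D - 1)) :
    2 * (D : ℝ) ^ 2 * A ^ 2 * γ * ‖negGrad x (diagPredictor D (p t) (m t))‖ ≤
      (∑ i, (D : ℝ) ^ 2 * ((p t i ^ (D - 1)) ^ 2 + (m t i ^ (D - 1)) ^ 2) *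
        negGrad x (diagPredictor D (p t) (m t)) i ^ 2) /
          expLoss x (diagPredictor D (p t) (m t)) := by
  set h := negGrad x (diagPredictor D (p t) (m t))
  have hL := expLoss_pos (x := x) hN (diagPredictor D (p t) (m t))
  have hγL := mul_expLoss_le_norm_negGrad hv hγ (diagPredictor D (p t) (m t))
  rw [le_div_iff₀ hL]
  calc 2 * (D : ℝ) ^ 2 * A ^ 2 * γ * ‖h‖ * expLoss x (diagPredictor D (p t) (m t))
      = 2 * (D : ℝ) ^ 2 * A ^ 2 * ‖h‖ * (γ * expLoss x (diagPredictor D (p t) (m t))) := by ring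
    _ ≤ 2 * (D : ℝ) ^ 2 * A ^ 2 * ‖h‖ * ‖h‖ := by gcongr
    _ = ∑ i, (D : ℝ) ^ 2 * (A ^ 2 + A ^ 2) * h i ^ 2 := by
        rw [← mul_sum, ← EuclideanSpace.real_norm_sq_eq]; ring
    _ ≤ _ := by
        gcongr with i _ i
        · exact hp i
        · exact hm i

variable {γ δ T : ℝ} {v : Fin d → ℝ}

/-- Before the smoothed margin becomes comparable with `α ^ D`, the weights stay close to their
initialization. -/
lemma abs_sub_lt (hflow : IsDiagFlow D x α p m) (hN : 0 < N) (hD : 0 < D) (hα : 0 < α)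
    (hv : ∑ i, v i ^ 2 = 1) (hγpos : 0 < γ) (hγ : ∀ n, γ ≤ ∑ i, x n i * v i)
    (hδ : 0 < δ) (hδ1 : δ < 1)
    (hsmall : ((1 + δ) ^ (D - 1) / (2 * D * ((1 - δ) ^ (D - 1)) ^ 2 * γ)) *
      -Real.log (expLoss x (diagPredictor D (p T) (m T))) < δ * α ^ D) :
    ∀ t ∈ Set.Icc 0 T, ∀ i, |p t i - α| < δ * α ∧ |m t i - α| < δ * α := by
  have hδα : 0 < δ * α := by positivity
  have hcp : ContinuousOn p (Set.Icc 0 T) := continuousOn_pi.2 fun i t ht =>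
    (hflow.deriv_pos t ht.1 i).continuousAt.continuousWithinAt
  have hcm : ContinuousOn m (Set.Icc 0 T) := continuousOn_pi.2 fun i t ht =>
    (hflow.deriv_neg t ht.1 i).continuousAt.continuousWithinAt
  have hiff : ∀ t, max ‖p t - fun _ => α‖ ‖m t - fun _ => α‖ < δ * α ↔
      ∀ i, |p t i - α| < δ * α ∧ |m t i - α| < δ * α := fun t => by
    rw [max_lt_iff, pi_norm_lt_iff hδα, pi_norm_lt_iff hδα, ← forall_and]
    rfl
  suffices H : ∀ t ∈ Set.Icc 0 T, max ‖p t - fun _ => α‖ ‖m t - fun _ => α‖ < δ * α from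
    fun t ht => (hiff t).1 (H t ht)
  refine forall_lt_of_bootstrap (by fun_prop) fun t ht hbefore => ?_
  simp only [hiff] at hbefore ⊢
  set G : ℝ → ℝ := fun s => -Real.log (expLoss x (diagPredictor D (p s) (m s))) with hG
  set A := ((1 - δ) * α) ^ (D - 1) with hAdef
  set B := ((1 + δ) * α) ^ (D - 1) with hBdef
  have h1δ : 0 < 1 - δ := by linarith
  have hA : 0 < A := by positivity
  have hB : 0 < B := by positivity
  have hD' : (0 : ℝ) < D := by exact_mod_cast hD
  set c := B / (2 * D * A ^ 2 * γ) with hc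
  have hc0 : 0 < c := by positivity
  have hGd := fun s hs => hflow.hasDerivAt_neg_log_expLoss hN (t := s) hs
  have hpow : ∀ u : ℝ, |u - α| < δ * α → A ≤ u ^ (D - 1) ∧ |u ^ (D - 1)| ≤ B := fun u hu =>
    pow_bounds_of_abs_sub_lt hα hδ1 hu _
  have hrate : ∀ s ∈ Set.Ico 0 t, ∀ i, ∀ u : ℝ, |u - α| < δ * α →
      |D * u ^ (D - 1) * negGrad x (diagPredictor D (p s) (m s)) i| ≤
      c * ((∑ i, (D : ℝ) ^ 2 * ((p s i ^ (D - 1)) ^ 2 + (m s i ^ (D - 1)) ^ 2) *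
        negGrad x (diagPredictor D (p s) (m s)) i ^ 2) /
          expLoss x (diagPredictor D (p s) (m s))) := fun s hs i u hu => by
    have hg := mul_norm_negGrad_le (p := p) (m := m) (D := D) hN hv hγ hA.le
      (fun i => (hpow _ (hbefore s hs i).1).1) (fun i => (hpow _ (hbefore s hs i).2).1)
    have hi : |negGrad x (diagPredictor D (p s) (m s)) i| ≤
        ‖negGrad x (diagPredictor D (p s) (m s))‖ :=
      PiLp.norm_apply_le (negGrad x (diagPredictor D (p s) (m s))) i
    calc _ = D * |u ^ (D - 1)| * |negGrad x (diagPredictor D (p s) (m s)) i| := by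
          rw [abs_mul, abs_mul, abs_of_pos hD']
      _ ≤ D * B * ‖negGrad x (diagPredictor D (p s) (m s))‖ := by
          gcongr
          exact (hpow u hu).2
      _ = c * (2 * (D : ℝ) ^ 2 * A ^ 2 * γ * ‖negGrad x (diagPredictor D (p s) (m s))‖) := by
          rw [hc]; field_simp
      _ ≤ _ := by gcongr
  have hcG : c * G t < δ * α := by
    have hmono : G t ≤ G T :=
      hflow.monotoneOn_neg_log_expLoss hN ht.1 (ht.1.trans ht.2) ht.2
    have hαD : α ^ D = α ^ (D - 1) * α := by rw [← pow_succ, Nat.sub_add_cancel hD]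
    have hceq : c = ((1 + δ) ^ (D - 1) / (2 * D * ((1 - δ) ^ (D - 1)) ^ 2 * γ)) /
        α ^ (D - 1) := by
      rw [hc, hAdef, hBdef, mul_pow, mul_pow]
      field_simp
    calc c * G t ≤ c * G T := by gcongr
      _ = ((1 + δ) ^ (D - 1) / (2 * D * ((1 - δ) ^ (D - 1)) ^ 2 * γ)) * G T /
        α ^ (D - 1) := by rw [hceq]; ring
      _ < δ * α := by
        rw [div_lt_iff₀ (by positivity)]
        calc _ < δ * α ^ D := hsmall
          _ = _ := by rw [hαD]; ring
  have hG0 : G 0 = 0 := hflow.neg_log_expLoss_zero hN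
  have hclose : ∀ (f f' : ℝ → ℝ), f 0 = α → (∀ s, 0 ≤ s → HasDerivAt f (f' s) s) →
      (∀ s ∈ Set.Ico 0 t, |f' s| ≤
        c * ((∑ i, (D : ℝ) ^ 2 * ((p s i ^ (D - 1)) ^ 2 + (m s i ^ (D - 1)) ^ 2) *
          negGrad x (diagPredictor D (p s) (m s)) i ^ 2) /
            expLoss x (diagPredictor D (p s) (m s)))) →
      |f t - α| < δ * α := fun f f' hf0 hf hbound => by
    refine lt_of_le_of_lt ?_ hcG
    refine image_norm_le_of_norm_deriv_right_le_deriv_boundary' (a := 0) (b := t)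
      (f := fun s => f s - α) (B := fun s => c * G s)
      (fun s hs => ((hf s hs.1).sub_const α).continuousAt.continuousWithinAt)
      (fun s hs => ((hf s hs.1).sub_const α).hasDerivWithinAt) ?_
      (fun s hs => ((hGd s hs.1).const_mul c).continuousAt.continuousWithinAt)
      (fun s hs => ((hGd s hs.1).const_mul c).hasDerivWithinAt) hbound
      ⟨ht.1, le_rfl⟩
    simp [hf0, hG0]
  refine fun i => ⟨hclose (fun s => p s i) _ (hflow.init_pos i)
    (fun s hs => hflow.deriv_pos s hs i) fun s hs => hrate s hs i _ (hbefore s hs i).1,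
    hclose (fun s => m s i) _ (hflow.init_neg i)
    (fun s hs => hflow.deriv_neg s hs i) fun s hs => ?_⟩
  rw [abs_neg]
  exact hrate s hs i _ (hbefore s hs i).2

/-- In the kernel regime the smoothed margin is almost `γ` times the norm of the predictor. -/
lemma norm_diagPredictor_le (hflow : IsDiagFlow D x α p m) (hN : 0 < N) (hD : 0 < D)
    (hα : 0 < α) (hv : ∑ i, v i ^ 2 = 1) (hγpos : 0 < γ) (hγ : ∀ n, γ ≤ ∑ i, x n i * v i)
    (hδ : 0 < δ) (hδ1 : δ < 1) (hT : 0 ≤ T)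
    (hsmall : ((1 + δ) ^ (D - 1) / (2 * D * ((1 - δ) ^ (D - 1)) ^ 2 * γ)) *
      -Real.log (expLoss x (diagPredictor D (p T) (m T))) < δ * α ^ D) :
    ‖(WithLp.toLp 2 (diagPredictor D (p T) (m T)) : EuclideanSpace ℝ (Fin d))‖ ≤
      (((1 + δ) / (1 - δ)) ^ (D - 1)) ^ 2 / γ *
        -Real.log (expLoss x (diagPredictor D (p T) (m T))) := by
  have hclose := hflow.abs_sub_lt hN hD hα hv hγpos hγ hδ hδ1 hsmall
  set A := ((1 - δ) * α) ^ (D - 1) with hAdef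
  set B := ((1 + δ) * α) ^ (D - 1) with hBdef
  have h1δ : 0 < 1 - δ := by linarith
  have hA : 0 < A := by positivity
  have hB : 0 < B := by positivity
  have hD' : (0 : ℝ) < D := by exact_mod_cast hD
  have hc : (((1 + δ) / (1 - δ)) ^ (D - 1)) ^ 2 / γ = B ^ 2 / (A ^ 2 * γ) := by
    rw [hAdef, hBdef, mul_pow (1 - δ), mul_pow (1 + δ), div_pow]
    field_simp
  have hpow : ∀ u : ℝ, |u - α| < δ * α → A ≤ u ^ (D - 1) ∧ |u ^ (D - 1)| ≤ B := fun u hu =>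
    pow_bounds_of_abs_sub_lt hα hδ1 hu _
  have hGd := fun s hs => hflow.hasDerivAt_neg_log_expLoss hN (t := s) hs
  have hWd : ∀ s, 0 ≤ s → HasDerivAt
      (fun s => (WithLp.toLp 2 (diagPredictor D (p s) (m s)) : EuclideanSpace ℝ (Fin d)))
      (WithLp.toLp 2 fun i => (D : ℝ) ^ 2 * ((p s i ^ (D - 1)) ^ 2 + (m s i ^ (D - 1)) ^ 2) *
        negGrad x (diagPredictor D (p s) (m s)) i) s := fun s hs =>
    
    (PiLp.hasFDerivAt_toLp 2 _).comp_hasDerivAt s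
      (hasDerivAt_pi.2 fun i => hflow.hasDerivAt_diagPredictor hs i)
  rw [hc]
  refine image_norm_le_of_norm_deriv_right_le_deriv_boundary' (a := 0) (b := T)
    (f := fun s => (WithLp.toLp 2 (diagPredictor D (p s) (m s)) : EuclideanSpace ℝ (Fin d)))
    (B := fun s => B ^ 2 / (A ^ 2 * γ) *
      -Real.log (expLoss x (diagPredictor D (p s) (m s))))
    (fun s hs => (hWd s hs.1).continuousAt.continuousWithinAt)
    (fun s hs => (hWd s hs.1).hasDerivWithinAt) ?_
    (fun s hs => ((hGd s hs.1).const_mul _).continuousAt.continuousWithinAt)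
    (fun s hs => ((hGd s hs.1).const_mul _).hasDerivWithinAt) (fun s hs => ?_)
    ⟨hT, le_rfl⟩
  · have hw0 : diagPredictor D (p 0) (m 0) = 0 := by
      ext i; simp [diagPredictor, hflow.init_pos, hflow.init_neg]
    rw [hflow.neg_log_expLoss_zero hN, hw0]
    simp
  · have hs' : s ∈ Set.Icc 0 T := ⟨hs.1, hs.2.le⟩
    have hp := fun i => hpow _ (hclose s hs' i).1
    have hm := fun i => hpow _ (hclose s hs' i).2
    have hg := mul_norm_negGrad_le (p := p) (m := m) (D := D) hN hv hγ hA.le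
      (fun i => (hp i).1) (fun i => (hm i).1)
    refine (norm_toLp_mul_le (M := (D : ℝ) ^ 2 * (B ^ 2 + B ^ 2)) (by positivity)
      (fun i => ?_) _).trans ?_
    · rw [abs_of_nonneg (by positivity)]
      have := hA.le.trans (hp i).1
      have := hA.le.trans (hm i).1
      gcongr
      · exact (le_abs_self _).trans (hp i).2
      · exact (le_abs_self _).trans (hm i).2
    · calc _ = B ^ 2 / (A ^ 2 * γ) * (2 * (D : ℝ) ^ 2 * A ^ 2 * γ *
            ‖negGrad x (diagPredictor D (p s) (m s))‖) := by field_simp; ring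
        _ ≤ _ := by gcongr

end IsDiagFlow

/-- A feasible vector whose norm is at most the inverse of the maximal margin is the strict
minimizer of the norm among feasible vectors. -/
lemma sum_sq_lt_of_isGreatest_margin_s8 {d N : ℕ} (hN : 0 < N) {x : Fin N → Fin d → ℝ} {γ : ℝ}
    (hγpos : 0 < γ)
    (hγ : IsGreatest {g : ℝ | ∃ v : Fin d → ℝ, (∑ i, (v i) ^ 2) = 1 ∧
      ∀ n, g ≤ ∑ i, x n i * v i} γ)
    {w v : Fin d → ℝ} (hw : ∀ n, 1 ≤ ∑ i, x n i * w i) (hv : ∀ n, 1 ≤ ∑ i, x n i * v i)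
    (hwγ : γ ^ 2 * ∑ i, w i ^ 2 ≤ 1) (hne : v ≠ w) :
    ∑ i, w i ^ 2 < ∑ i, v i ^ 2 := by
  have key : ∀ u : Fin d → ℝ, (∀ n, 1 ≤ ∑ i, x n i * u i) → 1 ≤ γ ^ 2 * ∑ i, u i ^ 2 := by
    intro u hu
    set S := ∑ i, u i ^ 2
    have hS0 : 0 ≤ S := by positivity
    have hSpos : 0 < S := by
      refine lt_of_le_of_ne hS0 fun h0 => ?_
      have hzero : ∀ i, u i = 0 := fun i => by
        simpa using (sum_eq_zero_iff_of_nonneg fun i _ => sq_nonneg (u i)).1 h0.symm i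
          (mem_univ i)
      have := hu ⟨0, hN⟩
      simp [hzero] at this
      linarith
    have hle : 1 / Real.sqrt S ≤ γ := hγ.2 ⟨fun i => u i / Real.sqrt S, by
      simp only [div_pow, ← sum_div, Real.sq_sqrt hS0]
      exact div_self hSpos.ne', fun n => by
      simp only [← mul_div_assoc, ← sum_div]
      gcongr
      exact hu n⟩
    rw [div_le_iff₀ (Real.sqrt_pos.2 hSpos)] at hle
    calc (1 : ℝ) = 1 ^ 2 := by norm_num
      _ ≤ (γ * Real.sqrt S) ^ 2 := by gcongr
      _ = γ ^ 2 * S := by rw [mul_pow, Real.sq_sqrt hS0]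
  by_contra! hle
  have hmid := key (fun i => (w i + v i) / 2) fun n => by
    have : ∑ i, x n i * ((w i + v i) / 2) = (∑ i, x n i * w i + ∑ i, x n i * v i) / 2 := by
      rw [← sum_add_distrib, sum_div]
      exact sum_congr rfl fun i _ => by ring
    rw [this]
    linarith [hw n, hv n]
  have hpar : ∑ i, ((w i + v i) / 2) ^ 2 =
      (∑ i, w i ^ 2 + ∑ i, v i ^ 2) / 2 - (∑ i, (v i - w i) ^ 2) / 4 := by
    rw [← sum_add_distrib, sum_div, sum_div, ← sum_sub_distrib]
    exact sum_congr rfl fun i _ => by ring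
  have hdist : 0 < ∑ i, (v i - w i) ^ 2 := by
    obtain ⟨i, hi⟩ := Function.ne_iff.1 hne
    have := sub_ne_zero.2 hi
    exact sum_pos' (fun _ _ => sq_nonneg _) ⟨i, mem_univ i, by positivity⟩
  have hγ2 : 0 < γ ^ 2 := by positivity
  rw [hpar] at hmid
  nlinarith [mul_le_mul_of_nonneg_left hle hγ2.le, mul_pos hγ2 hdist]

theorem stmt8
    (d N D : ℕ) (hd : 0 < d) (hN : 0 < N) (hD : 2 < D)
    (x : Fin N → Fin d → ℝ)
    (γ₂ : ℝ) (hγ₂pos : 0 < γ₂)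
    (hγ₂ : IsGreatest {g : ℝ | ∃ v : Fin d → ℝ, (∑ i, (v i)^2) = 1 ∧ ∀ n, g ≤ ∑ i, x n i * v i} γ₂)
    (up um : ℝ → ℝ → Fin d → ℝ)
    (hinit : ∀ a : ℝ, 0 < a → ∀ i, up a 0 i = a ∧ um a 0 i = a)
    (w : ℝ → ℝ → Fin d → ℝ)
    (hw : ∀ a t i, w a t i = (up a t i)^D - (um a t i)^D)
    (Lf : ℝ → ℝ → ℝ)
    (hLf : ∀ a t, Lf a t = (1 / (N:ℝ)) * ∑ n, Real.exp (-(∑ i, x n i * w a t i)))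
    (hflowp : ∀ a : ℝ, 0 < a → ∀ t, 0 ≤ t → ∀ i, HasDerivAt (fun s => up a s i)
        (((D:ℝ)/(N:ℝ)) * (up a t i)^(D-1) * ∑ n, Real.exp (-(∑ j, x n j * w a t j)) * x n i) t)
    (hflowm : ∀ a : ℝ, 0 < a → ∀ t, 0 ≤ t → ∀ i, HasDerivAt (fun s => um a s i)
        (-(((D:ℝ)/(N:ℝ)) * (um a t i)^(D-1) * ∑ n, Real.exp (-(∑ j, x n j * w a t j)) * x n i)) t)
    (ε : ℝ → ℝ)
    (hεanti : StrictAntiOn ε (Set.Ioi (0:ℝ)))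
    (hεrange : ∀ a : ℝ, 0 < a → 0 < ε a ∧ ε a ≤ 1)
    (hεlim : Filter.Tendsto ε Filter.atTop (nhds 0))
    (T : ℝ → ℝ)
    (hT : ∀ a : ℝ, 0 < a → 0 ≤ T a ∧ Lf a (T a) = ε a)
    (γm : ℝ → ℝ → ℝ)
    (hγm : ∀ a t, IsLeast {g : ℝ | ∃ n : Fin N, g = ∑ i, x n i * w a t i} (γm a t))
    (what : Fin d → ℝ)
    (hlim : Filter.Tendsto (fun a => fun i => w a (T a) i / γm a (T a)) Filter.atTop (nhds what))
    (hsmall : Filter.Tendsto (fun a => Real.log (1 / ε a) / a^D) Filter.atTop (nhds 0))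
    :
    (∀ n, 1 ≤ ∑ i, x n i * what i) ∧
    ∀ v : Fin d → ℝ, (∀ n, 1 ≤ ∑ i, x n i * v i) → v ≠ what →
      (∑ i, (what i)^2) < ∑ i, (v i)^2 := by
  obtain ⟨v₀, hv₀, hmargin⟩ := hγ₂.1
  have hD0 : 0 < D := by omega
  have hw' : ∀ a t, w a t = diagPredictor D (up a t) (um a t) := fun a t => funext (hw a t)
  have hLf' : ∀ a t, Lf a t = expLoss x (w a t) := hLf
  have hflow : ∀ a, 0 < a → IsDiagFlow D x a (up a) (um a) := fun a ha =>
    { init_pos := fun i => (hinit a ha i).1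
      init_neg := fun i => (hinit a ha i).2
      deriv_pos := fun t ht i => (hflowp a ha t ht i).congr_deriv (by
        rw [← hw', negGrad]; ring)
      deriv_neg := fun t ht i => (hflowm a ha t ht i).congr_deriv (by
        rw [← hw', negGrad]; ring) }
  have hlogε : ∀ a, Real.log (1 / ε a) = -Real.log (ε a) := fun a => by
    rw [one_div, Real.log_inv]
  have hγle : ∀ a, 0 < a → -Real.log (ε a) - Real.log N ≤ γm a (T a) := fun a ha => by
    have := neg_log_expLoss_le hN (hγm a (T a)).1
    rw [← hLf', (hT a ha).2] at this
    linarith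
  have hγtop : Tendsto (fun a => γm a (T a)) atTop atTop := by
    have hε0 : Tendsto ε atTop (𝓝[>] 0) := tendsto_nhdsWithin_iff.2
      ⟨hεlim, (eventually_gt_atTop 0).mono fun a ha => (hεrange a ha).1⟩
    refine tendsto_atTop_mono' _ ((eventually_gt_atTop 0).mono hγle) ?_
    exact tendsto_atTop_add_const_right _ _
      (tendsto_neg_atBot_atTop.comp (Real.tendsto_log_nhdsGT_zero.comp hε0))
  have hγpos : ∀ᶠ a in atTop, 0 < γm a (T a) := hγtop.eventually_gt_atTop 0
  have hfeas : ∀ n, 1 ≤ ∑ i, x n i * what i := fun n => by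
    have hlim' : Tendsto (fun a => ∑ i, x n i * (w a (T a) i / γm a (T a))) atTop
        (𝓝 (∑ i, x n i * what i)) :=
      tendsto_finsetSum _ fun i _ => (tendsto_pi_nhds.1 hlim i).const_mul _
    refine ge_of_tendsto hlim' (hγpos.mono fun a ha => ?_)
    simp only [← mul_div_assoc, ← sum_div]
    rw [le_div_iff₀ ha, one_mul]
    exact (hγm a (T a)).2 ⟨n, rfl⟩
  have hnormδ : ∀ δ : ℝ, 0 < δ → δ < 1 →
      ‖(WithLp.toLp 2 what : EuclideanSpace ℝ (Fin d))‖ ≤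
        (((1 + δ) / (1 - δ)) ^ (D - 1)) ^ 2 / γ₂ := fun δ hδ hδ1 => by
    have h1δ : 0 < 1 - δ := by linarith
    have hD' : (0 : ℝ) < D := by exact_mod_cast hD0
    set C := (1 + δ) ^ (D - 1) / (2 * D * ((1 - δ) ^ (D - 1)) ^ 2 * γ₂) with hC
    have hCpos : 0 < C := by positivity
    set R := (((1 + δ) / (1 - δ)) ^ (D - 1)) ^ 2 / γ₂ with hR
    have hRpos : 0 < R := by positivity
    have hlhs : Tendsto
        (fun a => ‖(WithLp.toLp 2 (fun i => w a (T a) i / γm a (T a)) :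
          EuclideanSpace ℝ (Fin d))‖) atTop (𝓝 ‖(WithLp.toLp 2 what : EuclideanSpace ℝ (Fin d))‖) :=
      ((PiLp.continuous_toLp 2 _).tendsto what |>.comp hlim).norm
    have hrhs : Tendsto (fun a => R * (1 + Real.log N / γm a (T a))) atTop (𝓝 R) := by
      simpa using ((hγtop.const_div_atTop (Real.log N)).const_add 1).const_mul R
    refine le_of_tendsto_of_tendsto hlhs hrhs ?_
    filter_upwards [eventually_gt_atTop 0, hγpos,
      hsmall.eventually_lt_const (show 0 < δ / C by positivity)] with a ha hγa hεa
    have hL : expLoss x (diagPredictor D (up a (T a)) (um a (T a))) = ε a := by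
      rw [← hw', ← hLf', (hT a ha).2]
    have hbound := (hflow a ha).norm_diagPredictor_le hN hD0 ha hv₀ hγ₂pos hmargin hδ hδ1
      (hT a ha).1 (by
        rw [hL, ← hlogε, ← hC]
        rw [div_lt_div_iff₀ (by positivity) hCpos] at hεa
        linarith)
    rw [hL, ← hw'] at hbound
    have hscale : (WithLp.toLp 2 (fun i => w a (T a) i / γm a (T a)) : EuclideanSpace ℝ (Fin d)) =
        (γm a (T a))⁻¹ • WithLp.toLp 2 (w a (T a)) := by
      ext i
      simp [div_eq_inv_mul]
    rw [hscale, norm_smul, norm_inv, Real.norm_of_nonneg hγa.le, inv_mul_le_iff₀ hγa]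
    calc _ ≤ R * -Real.log (ε a) := hbound
      _ ≤ R * (γm a (T a) + Real.log N) := by
          gcongr
          linarith [hγle a ha]
      _ = _ := by field_simp
  have hnorm : ‖(WithLp.toLp 2 what : EuclideanSpace ℝ (Fin d))‖ ≤ 1 / γ₂ := by
    have hcont : ContinuousAt (fun δ : ℝ => (((1 + δ) / (1 - δ)) ^ (D - 1)) ^ 2 / γ₂) 0 := by
      fun_prop (disch := norm_num)
    have hlimδ : Tendsto (fun δ : ℝ => (((1 + δ) / (1 - δ)) ^ (D - 1)) ^ 2 / γ₂) (𝓝[>] 0)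
        (𝓝 (1 / γ₂)) := by
      simpa using hcont.tendsto.mono_left nhdsWithin_le_nhds
    refine ge_of_tendsto hlimδ ?_
    filter_upwards [Ioo_mem_nhdsGT (zero_lt_one' ℝ)] with δ hδ
    exact hnormδ δ hδ.1 hδ.2
  refine ⟨hfeas, fun v hv hne => sum_sq_lt_of_isGreatest_margin_s8 hN hγ₂pos hγ₂ hfeas hv ?_ hne⟩
  have hsq : ∑ i, what i ^ 2 = ‖(WithLp.toLp 2 what : EuclideanSpace ℝ (Fin d))‖ ^ 2 := by
    rw [EuclideanSpace.real_norm_sq_eq]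
  rw [hsq, ← mul_pow]
  rw [le_div_iff₀ hγ₂pos] at hnorm
  exact pow_le_one₀ (by positivity) (by linarith)
end

section
/- Suppose D = 2, lim_{α→∞} α² / log(1/ε(α)) = μ for some μ > 0, and the stability condition holds. Then ŵ is the minimizer of Q²_μ(w) = Σ_{i=1}^d q(wᵢ/μ), where q(z) = 2 − √(4+z²) + z·arcsinh(z/2), over w ∈ ℝ^d subject to x_nᵀw ≥ 1 for all n ∈ {1,…,N}. -/
open Real Finset Filter Topology MeasureTheory

theorem cosh_add_sub_mul_sinh_le (s t : ℝ) :
    Real.cosh t + (s - t) * Real.sinh t ≤ Real.cosh s := by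
  have h1 := Real.add_one_le_exp (s - t)
  have h2 := Real.add_one_le_exp (-(s - t))
  have e1 : Real.exp s = Real.exp t * Real.exp (s - t) := by rw [← Real.exp_add]; ring_nf
  have e2 : Real.exp (-s) = Real.exp (-t) * Real.exp (-(s - t)) := by
    rw [← Real.exp_add]; ring_nf
  rw [Real.cosh_eq, Real.cosh_eq, Real.sinh_eq, e1, e2]
  nlinarith [mul_le_mul_of_nonneg_left h1 (Real.exp_pos t).le,
    mul_le_mul_of_nonneg_left h2 (Real.exp_pos (-t)).le]

/-- The hyperbolic entropy `q z = 2 - √(4 + z²) + z arsinh (z / 2)` in the coordinate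
`z = 2 sinh t`. -/
theorem hypentropy_eq (z : ℝ) :
    2 - Real.sqrt (4 + z ^ 2) + z * Real.arsinh (z / 2) =
      2 - 2 * Real.cosh (Real.arsinh (z / 2))
        + 2 * Real.arsinh (z / 2) * Real.sinh (Real.arsinh (z / 2)) := by
  have h : Real.sqrt (4 + z ^ 2) = 2 * Real.sqrt (1 + (z / 2) ^ 2) := by
    rw [show 4 + z ^ 2 = 2 ^ 2 * (1 + (z / 2) ^ 2) by ring,
      Real.sqrt_mul (by positivity), Real.sqrt_sq (by norm_num)]
  rw [Real.cosh_arsinh, Real.sinh_arsinh, h]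
  ring

/-- The tangent line inequality for the hyperbolic entropy, whose derivative at `y` is
`arsinh (y / 2)`. -/
theorem hypentropy_tangent_le (y z : ℝ) :
    2 - Real.sqrt (4 + y ^ 2) + y * Real.arsinh (y / 2) + Real.arsinh (y / 2) * (z - y) ≤
      2 - Real.sqrt (4 + z ^ 2) + z * Real.arsinh (z / 2) := by
  have h := cosh_add_sub_mul_sinh_le (Real.arsinh (y / 2)) (Real.arsinh (z / 2))
  have hy := Real.sinh_arsinh (y / 2)
  have hz := Real.sinh_arsinh (z / 2)
  have e : Real.arsinh (y / 2) * (z - y) = 2 * Real.arsinh (y / 2) *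
      (Real.sinh (Real.arsinh (z / 2)) - Real.sinh (Real.arsinh (y / 2))) := by
    rw [hy, hz]; ring
  rw [hypentropy_eq, hypentropy_eq, e]
  nlinarith

/-- A solution of `u' = g' u` on `[0, ∞)` is an exponential. -/
theorem eq_mul_exp_of_hasDerivAt_s9 {u g g' : ℝ → ℝ} {a : ℝ} (h0 : u 0 = a) (hg0 : g 0 = 0)
    (hg : ∀ t, 0 ≤ t → HasDerivAt g (g' t) t)
    (hu : ∀ t, 0 ≤ t → HasDerivAt u (g' t * u t) t) {t : ℝ} (ht : 0 ≤ t) :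
    u t = a * Real.exp (g t) := by
  have hd : ∀ s, 0 ≤ s → HasDerivAt (fun s => u s * Real.exp (-g s)) 0 s := by
    intro s hs
    exact ((hu s hs).fun_mul (hg s hs).fun_neg.exp).congr_deriv (by ring)
  have hc := constant_of_has_deriv_right_zero (a := 0) (b := t)
    (f := fun s => u s * Real.exp (-g s))
    (fun s hs => (hd s hs.1).continuousAt.continuousWithinAt)
    (fun s hs => (hd s hs.1).hasDerivWithinAt) t ⟨ht, le_rfl⟩
  simp only [h0, hg0, neg_zero, Real.exp_zero, mul_one] at hc
  rw [← hc, mul_assoc, ← Real.exp_add]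
  simp

/-- A function continuous at every point of `[0, ∞)` has an antiderivative there. -/
theorem exists_antideriv_of_continuousAt {r : ℝ → ℝ} (hr : ∀ t, 0 ≤ t → ContinuousAt r t) :
    ∃ R : ℝ → ℝ, R 0 = 0 ∧ ∀ t, 0 ≤ t → HasDerivAt R (r t) t := by
  have hc : ContinuousOn r (Set.Ici 0) := fun t ht => (hr t ht).continuousWithinAt
  have hc' : Continuous (fun t => r (max t 0)) :=
    hc.comp_continuous (by fun_prop) (fun t => le_max_right t 0)
  let F : ℝ → ℝ := fun t => ∫ s in (0 : ℝ)..t, r (max s 0)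
  refine ⟨F, by simp [F], fun t ht => ?_⟩
  have h := intervalIntegral.integral_hasDerivAt_right (hc'.intervalIntegrable 0 t)
    (hc'.stronglyMeasurableAtFilter _ _) hc'.continuousAt
  rwa [max_eq_left ht] at h

/-- Increments are compared by comparing derivatives. -/
theorem sub_le_mul_sub_of_deriv_le {f g f' g' : ℝ → ℝ} {κ s t : ℝ} (hst : s ≤ t)
    (hf : ∀ τ ∈ Set.Icc s t, HasDerivAt f (f' τ) τ)
    (hg : ∀ τ ∈ Set.Icc s t, HasDerivAt g (g' τ) τ)
    (h : ∀ τ ∈ Set.Icc s t, f' τ ≤ κ * g' τ) :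
    f t - f s ≤ κ * (g t - g s) := by
  have hd : ∀ τ ∈ Set.Icc s t, HasDerivAt (fun τ => κ * g τ - f τ) (κ * g' τ - f' τ) τ :=
    fun τ hτ => ((hg τ hτ).const_mul κ).sub (hf τ hτ)
  have hm : MonotoneOn (fun τ => κ * g τ - f τ) (Set.Icc s t) := by
    refine monotoneOn_of_hasDerivWithinAt_nonneg (convex_Icc s t)
      (fun τ hτ => (hd τ hτ).continuousAt.continuousWithinAt)
      (fun τ hτ => (hd τ (interior_subset hτ)).hasDerivWithinAt)
      (fun τ hτ => sub_nonneg.2 (h τ (interior_subset hτ)))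
  have := hm (Set.left_mem_Icc.2 hst) (Set.right_mem_Icc.2 hst) hst
  simp only at this
  linarith

/-- Closed form of the flow of a depth-two diagonal linear network in terms of the accumulated
residuals `R`. -/
theorem exists_residual_integral {d N : ℕ} (x : Fin N → Fin d → ℝ) (up um w : ℝ → Fin d → ℝ)
    (a : ℝ) (hinit : ∀ i, up 0 i = a ∧ um 0 i = a)
    (hw : ∀ t i, w t i = (up t i) ^ 2 - (um t i) ^ 2)
    (hp : ∀ t, 0 ≤ t → ∀ i, HasDerivAt (fun s => up s i)
      ((2 / (N : ℝ)) * up t i * ∑ n, Real.exp (-(∑ j, x n j * w t j)) * x n i) t)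
    (hm : ∀ t, 0 ≤ t → ∀ i, HasDerivAt (fun s => um s i)
      (-((2 / (N : ℝ)) * um t i * ∑ n, Real.exp (-(∑ j, x n j * w t j)) * x n i)) t) :
    ∃ R : Fin N → ℝ → ℝ, (∀ n, R n 0 = 0) ∧
      (∀ n t, 0 ≤ t → HasDerivAt (R n) ((1 / (N : ℝ)) * Real.exp (-(∑ j, x n j * w t j))) t) ∧
      ∀ t, 0 ≤ t → ∀ i, w t i = 2 * a ^ 2 * Real.sinh (4 * ∑ n, R n t * x n i) := by
  have hwc : ∀ t, 0 ≤ t → ∀ i, ContinuousAt (fun s => w s i) t := by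
    intro t ht i
    simp only [hw]
    exact ((hp t ht i).continuousAt.pow 2).sub ((hm t ht i).continuousAt.pow 2)
  have hR : ∀ n : Fin N, ∃ R : ℝ → ℝ, R 0 = 0 ∧ ∀ t, 0 ≤ t →
      HasDerivAt R ((1 / (N : ℝ)) * Real.exp (-(∑ j, x n j * w t j))) t := by
    intro n
    refine exists_antideriv_of_continuousAt (fun t ht => ?_)
    refine ContinuousAt.mul continuousAt_const (ContinuousAt.rexp (ContinuousAt.neg ?_))
    exact tendsto_finsetSum _ (fun j _ => (continuousAt_const.mul (hwc t ht j)))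
  choose R hR0 hRd using hR
  refine ⟨R, hR0, hRd, fun t ht i => ?_⟩
  have hsum : ∀ s, 0 ≤ s → HasDerivAt (fun s => ∑ n, R n s * x n i)
      (∑ n, (1 / (N : ℝ)) * Real.exp (-(∑ j, x n j * w s j)) * x n i) s :=
    fun s hs => HasDerivAt.fun_sum (fun n _ => (hRd n s hs).mul_const _)
  have hfac : ∀ s, ∑ n, (1 / (N : ℝ)) * Real.exp (-(∑ j, x n j * w s j)) * x n i =
      (1 / (N : ℝ)) * ∑ n, Real.exp (-(∑ j, x n j * w s j)) * x n i := by
    intro s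
    rw [Finset.mul_sum]
    exact Finset.sum_congr rfl (fun n _ => by ring)
  have e1 := eq_mul_exp_of_hasDerivAt_s9 (u := fun s => up s i)
    (g := fun s => 2 * ∑ n, R n s * x n i) (hinit i).1 (by simp [hR0])
    (fun s hs => (hsum s hs).const_mul 2)
    (fun s hs => by
      convert hp s hs i using 1
      rw [hfac]; ring) ht
  have e2 := eq_mul_exp_of_hasDerivAt_s9 (u := fun s => um s i)
    (g := fun s => -2 * ∑ n, R n s * x n i) (hinit i).2 (by simp [hR0])
    (fun s hs => (hsum s hs).const_mul (-2))
    (fun s hs => by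
      convert hm s hs i using 1
      rw [hfac]; ring) ht
  rw [hw, e1, e2, Real.sinh_eq, mul_pow, mul_pow, ← Real.exp_nat_mul, ← Real.exp_nat_mul]
  push_cast
  ring_nf

/-- Along the flow the logarithmic loss grows at rate at least `8 a² g² L`, where `g` is a lower
bound for the margin of a unit vector. -/
theorem exists_hasDerivAt_neg_log_loss {d N : ℕ} (hN : 0 < N) (x : Fin N → Fin d → ℝ)
    (w : ℝ → Fin d → ℝ) (a g : ℝ) (hg : 0 < g) (v : Fin d → ℝ) (hv : ∑ i, (v i) ^ 2 = 1)
    (hvg : ∀ n, g ≤ ∑ i, x n i * v i) (R : Fin N → ℝ → ℝ) (L : ℝ → ℝ)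
    (hL : ∀ t, L t = (1 / (N : ℝ)) * ∑ n, Real.exp (-(∑ i, x n i * w t i)))
    (hwR : ∀ t i, w t i = 2 * a ^ 2 * Real.sinh (4 * ∑ n, R n t * x n i)) (t : ℝ)
    (hRd : ∀ n, HasDerivAt (R n) ((1 / (N : ℝ)) * Real.exp (-(∑ j, x n j * w t j))) t) :
    ∃ l', HasDerivAt (fun s => -Real.log (L s)) l' t ∧ 8 * a ^ 2 * g ^ 2 * L t ≤ l' := by
  have hNR : (0 : ℝ) < N := by exact_mod_cast hN
  have hne : Nonempty (Fin N) := ⟨⟨0, hN⟩⟩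
  set r : Fin N → ℝ := fun n => (1 / (N : ℝ)) * Real.exp (-(∑ j, x n j * w t j)) with hr
  set y : Fin d → ℝ := fun i => ∑ n, r n * x n i with hy
  set c : Fin d → ℝ := fun i => Real.cosh (4 * ∑ n, R n t * x n i) with hc
  have hrpos : ∀ n, 0 < r n := fun n => by positivity
  have hLr : L t = ∑ n, r n := by rw [hL, Finset.mul_sum]
  have hLpos : 0 < L t := by
    rw [hLr]; exact Finset.sum_pos (fun n _ => hrpos n) Finset.univ_nonempty
  have hwd : ∀ i, HasDerivAt (fun s => w s i) (2 * a ^ 2 * (c i * (4 * y i))) t := by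
    intro i
    simp only [hwR]
    exact (((HasDerivAt.fun_sum (fun n _ => (hRd n).mul_const (x n i))).const_mul 4).sinh).const_mul
      (2 * a ^ 2)
  have hmd : ∀ n, HasDerivAt (fun s => ∑ i, x n i * w s i)
      (∑ i, x n i * (2 * a ^ 2 * (c i * (4 * y i)))) t :=
    fun n => HasDerivAt.fun_sum (fun i _ => (hwd i).const_mul (x n i))
  have hLd : HasDerivAt L (-(8 * a ^ 2 * ∑ i, c i * y i ^ 2)) t := by
    have h : HasDerivAt (fun s => (1 / (N : ℝ)) * ∑ n, Real.exp (-(∑ i, x n i * w s i)))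
        ((1 / (N : ℝ)) * ∑ n, Real.exp (-(∑ i, x n i * w t i)) *
          -(∑ i, x n i * (2 * a ^ 2 * (c i * (4 * y i))))) t :=
      (HasDerivAt.fun_sum (fun n _ => (hmd n).fun_neg.exp)).const_mul _
    rw [show L = fun s => _ from funext hL]
    convert h using 1
    have e : ∀ n, (1 / (N : ℝ)) * (Real.exp (-(∑ i, x n i * w t i)) *
        -(∑ i, x n i * (2 * a ^ 2 * (c i * (4 * y i))))) =
        ∑ i, -(8 * a ^ 2 * (c i * y i * (r n * x n i))) := by
      intro n
      rw [mul_neg, mul_neg, ← mul_assoc, Finset.mul_sum, ← Finset.sum_neg_distrib]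
      exact Finset.sum_congr rfl (fun i _ => by simp only [hr]; ring)
    rw [Finset.mul_sum univ _ (1 / (N : ℝ)), Finset.sum_congr rfl (fun n _ => e n),
      Finset.sum_comm, Finset.mul_sum, ← Finset.sum_neg_distrib]
    refine Finset.sum_congr rfl (fun i _ => ?_)
    rw [Finset.sum_neg_distrib, ← Finset.mul_sum, ← Finset.mul_sum]
    simp only [hy]
    ring
  have hgL : g * L t ≤ ∑ i, v i * y i := by
    have e : ∑ i, v i * y i = ∑ n, r n * ∑ i, x n i * v i := by
      simp only [hy, Finset.mul_sum]
      rw [Finset.sum_comm]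
      exact Finset.sum_congr rfl (fun n _ => Finset.sum_congr rfl (fun i _ => by ring))
    rw [e, hLr, Finset.mul_sum]
    refine Finset.sum_le_sum (fun n _ => ?_)
    rw [mul_comm]
    exact mul_le_mul_of_nonneg_left (hvg n) (hrpos n).le
  have hcs : (g * L t) ^ 2 ≤ ∑ i, c i * y i ^ 2 := by
    calc (g * L t) ^ 2 ≤ (∑ i, v i * y i) ^ 2 := by gcongr
      _ ≤ (∑ i, v i ^ 2) * ∑ i, y i ^ 2 := Finset.sum_mul_sq_le_sq_mul_sq _ _ _
      _ = ∑ i, y i ^ 2 := by rw [hv, one_mul]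
      _ ≤ ∑ i, c i * y i ^ 2 := Finset.sum_le_sum
          (fun i _ => le_mul_of_one_le_left (sq_nonneg _) (Real.one_le_cosh _))
  refine ⟨_, (hLd.log hLpos.ne').fun_neg, ?_⟩
  rw [neg_div, neg_neg, le_div_iff₀ hLpos]
  nlinarith [mul_le_mul_of_nonneg_left hcs (show 0 ≤ 8 * a ^ 2 by positivity)]

/-- The accumulated residual of a sample whose residual is at most `η L` once `-log L ≥ θ`. -/
theorem residual_integral_le {d N : ℕ} (hN : 0 < N) (x : Fin N → Fin d → ℝ)
    (w : ℝ → Fin d → ℝ) (a g : ℝ) (ha : 0 < a) (hg : 0 < g) (v : Fin d → ℝ)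
    (hv : ∑ i, (v i) ^ 2 = 1)
    (hvg : ∀ n, g ≤ ∑ i, x n i * v i) (R : Fin N → ℝ → ℝ) (L : ℝ → ℝ)
    (hL : ∀ t, L t = (1 / (N : ℝ)) * ∑ n, Real.exp (-(∑ i, x n i * w t i)))
    (hwR : ∀ t i, w t i = 2 * a ^ 2 * Real.sinh (4 * ∑ n, R n t * x n i))
    (hR0 : ∀ n, R n 0 = 0)
    (hRd : ∀ n t, 0 ≤ t →
      HasDerivAt (R n) ((1 / (N : ℝ)) * Real.exp (-(∑ j, x n j * w t j))) t)
    (k : Fin N) (T θ η : ℝ) (hT : 0 ≤ T) (hθ : 0 ≤ θ) (hη : 0 ≤ η)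
    (h : ∀ t, 0 ≤ t → θ ≤ -Real.log (L t) → -Real.log (L t) ≤ -Real.log (L T) →
      (1 / (N : ℝ)) * Real.exp (-(∑ j, x k j * w t j)) ≤ η * L t) :
    R k T ≤ (θ + η * -Real.log (L T)) / (8 * a ^ 2 * g ^ 2) := by
  have hNR : (0 : ℝ) < N := by exact_mod_cast hN
  have hne : Nonempty (Fin N) := ⟨⟨0, hN⟩⟩
  have hLpos : ∀ t, 0 < L t := fun t => by
    rw [hL]; exact mul_pos (by positivity) (Finset.sum_pos (fun n _ => Real.exp_pos _)
      Finset.univ_nonempty)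
  have hrL : ∀ t, (1 / (N : ℝ)) * Real.exp (-(∑ j, x k j * w t j)) ≤ L t := fun t => by
    rw [hL]
    exact mul_le_mul_of_nonneg_left (Finset.single_le_sum
      (f := fun n => Real.exp (-(∑ j, x n j * w t j)))
      (fun n _ => (Real.exp_pos _).le) (Finset.mem_univ k)) (by positivity)
  have hL0 : L 0 = 1 := by
    rw [hL]
    simp only [hwR, hR0]
    simp [hNR.ne']
  have hex : ∀ t, ∃ l', 0 ≤ t → HasDerivAt (fun s => -Real.log (L s)) l' t ∧
      8 * a ^ 2 * g ^ 2 * L t ≤ l' := by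
    intro t
    by_cases ht : 0 ≤ t
    · obtain ⟨l', hl⟩ := exists_hasDerivAt_neg_log_loss hN x w a g hg v hv hvg R L hL hwR t
        (fun n => hRd n t ht)
      exact ⟨l', fun _ => hl⟩
    · exact ⟨0, fun h => absurd h ht⟩
  choose l' hl using hex
  set ℓ : ℝ → ℝ := fun s => -Real.log (L s) with hℓ
  have hℓ0 : ℓ 0 = 0 := by simp [hℓ, hL0]
  set c := 8 * a ^ 2 * g ^ 2 with hc
  have hcpos : 0 < c := by positivity
  have hl0 : ∀ t, 0 ≤ t → 0 ≤ l' t := fun t ht =>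
    (mul_pos hcpos (hLpos t)).le.trans (hl t ht).2
  have hmono : ∀ s t, 0 ≤ s → s ≤ t → ℓ s ≤ ℓ t := by
    intro s t hs hst
    have := sub_le_mul_sub_of_deriv_le (f := fun _ => (0 : ℝ)) (f' := fun _ => 0) (g := ℓ)
      (g' := l') (κ := 1) hst (fun τ _ => hasDerivAt_const τ 0)
      (fun τ hτ => (hl τ (hs.trans hτ.1)).1)
      (fun τ hτ => by simpa using hl0 τ (hs.trans hτ.1))
    linarith
  have hinc : ∀ s t κ, 0 ≤ s → s ≤ t → 0 ≤ κ →
      (∀ τ ∈ Set.Icc s t, (1 / (N : ℝ)) * Real.exp (-(∑ j, x k j * w τ j)) ≤ κ * L τ) →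
      R k t - R k s ≤ κ / c * (ℓ t - ℓ s) := by
    intro s t κ hs hst hκ hle
    refine sub_le_mul_sub_of_deriv_le hst (fun τ hτ => hRd k τ (hs.trans hτ.1))
      (fun τ hτ => (hl τ (hs.trans hτ.1)).1) (fun τ hτ => (hle τ hτ).trans ?_)
    rw [div_mul_eq_mul_div, le_div_iff₀ hcpos]
    nlinarith [mul_le_mul_of_nonneg_left (hl τ (hs.trans hτ.1)).2 hκ]
  have hℓT : 0 ≤ ℓ T := hℓ0 ▸ hmono 0 T le_rfl hT
  change R k T ≤ (θ + η * ℓ T) / c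
  rw [le_div_iff₀ hcpos]
  have hearly : ∀ s, 0 ≤ s → R k s * c ≤ ℓ s := by
    intro s hs
    have := hinc 0 s 1 le_rfl hs zero_le_one (fun τ _ => by simpa using hrL τ)
    rw [hR0, hℓ0, div_mul_eq_mul_div, le_div_iff₀ hcpos] at this
    linarith
  rcases le_total (ℓ T) θ with hcase | hcase
  · nlinarith [hearly T hT, mul_nonneg hη hℓT]
  · obtain ⟨s, ⟨hs0, hsT⟩, hsθ⟩ : θ ∈ ℓ '' Set.Icc 0 T :=
      intermediate_value_Icc hT
        (fun τ hτ => (hl τ hτ.1).1.continuousAt.continuousWithinAt) ⟨hℓ0.trans_le hθ, hcase⟩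
    have h2 := hinc s T η hs0 hsT hη (fun τ hτ => h τ (hs0.trans hτ.1)
      (hsθ ▸ hmono s τ hs0 hτ.1) (hmono τ T (hs0.trans hτ.1) hτ.2))
    rw [div_mul_eq_mul_div, le_div_iff₀ hcpos] at h2
    nlinarith [hearly s hs0, mul_nonneg hη hθ]

/-- The margin agrees with the logarithmic loss up to `log N`. -/
theorem margin_le_neg_log_loss_le {d N : ℕ} (hN : 0 < N) (x : Fin N → Fin d → ℝ)
    (w : Fin d → ℝ) (L γ : ℝ)
    (hL : L = (1 / (N : ℝ)) * ∑ n, Real.exp (-(∑ i, x n i * w i)))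
    (hγ : IsLeast {g : ℝ | ∃ n : Fin N, g = ∑ i, x n i * w i} γ) :
    0 < L ∧ γ ≤ -Real.log L ∧ -Real.log L ≤ γ + Real.log N ∧
      (1 / (N : ℝ)) * Real.exp (-γ) ≤ L := by
  have hNR : (0 : ℝ) < N := by exact_mod_cast hN
  obtain ⟨⟨m, hm⟩, hlb⟩ := hγ
  have h1 : L ≤ Real.exp (-γ) := by
    rw [hL, one_div, inv_mul_le_iff₀ hNR]
    calc ∑ n, Real.exp (-(∑ i, x n i * w i)) ≤ ∑ _n : Fin N, Real.exp (-γ) :=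
          Finset.sum_le_sum (fun n _ => Real.exp_le_exp.2 (neg_le_neg (hlb ⟨n, rfl⟩)))
      _ = N * Real.exp (-γ) := by simp
  have h2 : (1 / (N : ℝ)) * Real.exp (-γ) ≤ L := by
    rw [hL, hm]
    exact mul_le_mul_of_nonneg_left (Finset.single_le_sum
      (f := fun n => Real.exp (-(∑ i, x n i * w i)))
      (fun n _ => (Real.exp_pos _).le) (Finset.mem_univ m)) (by positivity)
  have hpos : 0 < L := lt_of_lt_of_le (by positivity) h2
  refine ⟨hpos, ?_, ?_, h2⟩
  · have := Real.log_le_log hpos h1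
    rw [Real.log_exp] at this
    linarith
  · have := Real.log_le_log (by positivity) h2
    rw [Real.log_mul (by positivity) (by positivity), Real.log_exp, one_div,
      Real.log_inv] at this
    linarith

theorem stmt9
    (d N D : ℕ) (hd : 0 < d) (hN : 0 < N) (hD : 2 ≤ D) (hD2 : D = 2)
    (x : Fin N → Fin d → ℝ)
    (γ₂ : ℝ) (hγ₂pos : 0 < γ₂)
    (hγ₂ : IsGreatest {g : ℝ | ∃ v : Fin d → ℝ, (∑ i, (v i)^2) = 1 ∧ ∀ n, g ≤ ∑ i, x n i * v i} γ₂)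
    (up um : ℝ → ℝ → Fin d → ℝ)
    (hinit : ∀ a : ℝ, 0 < a → ∀ i, up a 0 i = a ∧ um a 0 i = a)
    (w : ℝ → ℝ → Fin d → ℝ)
    (hw : ∀ a t i, w a t i = (up a t i)^D - (um a t i)^D)
    (Lf : ℝ → ℝ → ℝ)
    (hLf : ∀ a t, Lf a t = (1 / (N:ℝ)) * ∑ n, Real.exp (-(∑ i, x n i * w a t i)))
    (hflowp : ∀ a : ℝ, 0 < a → ∀ t, 0 ≤ t → ∀ i, HasDerivAt (fun s => up a s i)
        (((D:ℝ)/(N:ℝ)) * (up a t i)^(D-1) * ∑ n, Real.exp (-(∑ j, x n j * w a t j)) * x n i) t)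
    (hflowm : ∀ a : ℝ, 0 < a → ∀ t, 0 ≤ t → ∀ i, HasDerivAt (fun s => um a s i)
        (-(((D:ℝ)/(N:ℝ)) * (um a t i)^(D-1) * ∑ n, Real.exp (-(∑ j, x n j * w a t j)) * x n i)) t)
    (ε : ℝ → ℝ)
    (hεanti : StrictAntiOn ε (Set.Ioi (0:ℝ)))
    (hεrange : ∀ a : ℝ, 0 < a → 0 < ε a ∧ ε a ≤ 1)
    (hεlim : Filter.Tendsto ε Filter.atTop (nhds 0))
    (T : ℝ → ℝ)
    (hT : ∀ a : ℝ, 0 < a → 0 ≤ T a ∧ Lf a (T a) = ε a)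
    (γm : ℝ → ℝ → ℝ)
    (hγm : ∀ a t, IsLeast {g : ℝ | ∃ n : Fin N, g = ∑ i, x n i * w a t i} (γm a t))
    (what : Fin d → ℝ)
    (hlim : Filter.Tendsto (fun a => fun i => w a (T a) i / γm a (T a)) Filter.atTop (nhds what))
    (μ : ℝ) (hμpos : 0 < μ)
    (hμ : Filter.Tendsto (fun a => a^2 / Real.log (1 / ε a)) Filter.atTop (nhds μ))
    (hstab : ∀ k : Fin N, 1 < (∑ i, x k i * what i) →
      ∃ γs : ℝ → ℝ, Filter.Tendsto (fun a => γs a / a^D) Filter.atTop (nhds 0) ∧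
      ∃ ρ₀ : ℝ, 1 < ρ₀ ∧
      ∃ A : ℝ, ∀ a, A ≤ a → ∀ t, 0 ≤ t →
        γs a ≤ -Real.log (Lf a t) → -Real.log (Lf a t) ≤ Real.log (1 / ε a) →
        ρ₀ ≤ (∑ i, x k i * w a t i) / γm a t)
    :
    (∀ n, 1 ≤ ∑ i, x n i * what i) ∧
    ∀ v : Fin d → ℝ, (∀ n, 1 ≤ ∑ i, x n i * v i) →
      (∑ i, (2 - Real.sqrt (4 + (what i / μ)^2) + (what i / μ) * Real.arsinh ((what i / μ) / 2))) ≤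
      ∑ i, (2 - Real.sqrt (4 + (v i / μ)^2) + (v i / μ) * Real.arsinh ((v i / μ) / 2)) := by
  subst hD2
  obtain ⟨⟨v₀, hv₀, hv₀x⟩, -⟩ := hγ₂
  have hex : ∀ a : ℝ, ∃ R : Fin N → ℝ → ℝ, 0 < a → (∀ n, R n 0 = 0) ∧
      (∀ n t, 0 ≤ t →
        HasDerivAt (R n) ((1 / (N : ℝ)) * Real.exp (-(∑ j, x n j * w a t j))) t) ∧
      ∀ t, 0 ≤ t → ∀ i, w a t i = 2 * a ^ 2 * Real.sinh (4 * ∑ n, R n t * x n i) := by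
    intro a
    by_cases ha : 0 < a
    · obtain ⟨R, hR⟩ := exists_residual_integral x (up a) (um a) (w a) a (hinit a ha)
        (hw a) (fun t ht i => by simpa using hflowp a ha t ht i)
        (fun t ht i => by simpa using hflowm a ha t ht i)
      exact ⟨R, fun _ => hR⟩
    · exact ⟨fun _ _ => 0, fun h => absurd h ha⟩
  choose R hR using hex
  have hmargin : ∀ a t, 0 < Lf a t ∧ γm a t ≤ -Real.log (Lf a t) ∧
      -Real.log (Lf a t) ≤ γm a t + Real.log N ∧
      (1 / (N : ℝ)) * Real.exp (-γm a t) ≤ Lf a t :=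
    fun a t => margin_le_neg_log_loss_le hN x (w a t) _ _ (hLf a t) (hγm a t)
  have hlogT : ∀ a, 0 < a → -Real.log (Lf a (T a)) = Real.log (1 / ε a) := fun a ha => by
    rw [(hT a ha).2, one_div, Real.log_inv]
  have hsq : Tendsto (fun a : ℝ => a ^ 2) atTop atTop := tendsto_pow_atTop (by norm_num)
  have hℓ : Tendsto (fun a => Real.log (1 / ε a) / a ^ 2) atTop (𝓝 μ⁻¹) := by
    simpa only [inv_div] using hμ.inv₀ hμpos.ne'
  have hγ : Tendsto (fun a => γm a (T a) / a ^ 2) atTop (𝓝 μ⁻¹) := by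
    have hlow : Tendsto (fun a => Real.log (1 / ε a) / a ^ 2 - Real.log N / a ^ 2) atTop
        (𝓝 μ⁻¹) := by
      simpa using hℓ.sub (hsq.const_div_atTop (Real.log N))
    refine tendsto_of_tendsto_of_tendsto_of_le_of_le' hlow hℓ ?_ ?_
    · filter_upwards [eventually_gt_atTop 0] with a ha
      rw [← sub_div]
      gcongr
      linarith [(hmargin a (T a)).2.2.1, hlogT a ha]
    · filter_upwards [eventually_gt_atTop 0] with a ha
      gcongr
      linarith [(hmargin a (T a)).2.1, hlogT a ha]
  have hγpos : ∀ᶠ a in atTop, 0 < γm a (T a) := by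
    filter_upwards [hγ.eventually_const_lt (inv_pos.2 hμpos), eventually_gt_atTop 0] with a h ha
    exact (div_pos_iff_of_pos_right (by positivity)).1 h
  have hcoord := tendsto_pi_nhds.1 hlim
  have hfeas : ∀ n, 1 ≤ ∑ i, x n i * what i := by
    intro n
    have hs : Tendsto (fun a => ∑ i, x n i * (w a (T a) i / γm a (T a))) atTop
        (𝓝 (∑ i, x n i * what i)) :=
      tendsto_finsetSum _ (fun i _ => (hcoord i).const_mul (x n i))
    refine ge_of_tendsto hs ?_
    filter_upwards [hγpos] with a ha
    have := (hγm a (T a)).2 ⟨n, rfl⟩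
    simp only [← mul_div_assoc]
    rw [← Finset.sum_div, one_le_div ha]
    exact this
  refine ⟨hfeas, fun v hv => ?_⟩
  have hRnonneg : ∀ a, 0 < a → ∀ n, 0 ≤ R a n (T a) := by
    intro a ha n
    obtain ⟨h0, hd, -⟩ := hR a ha
    have := sub_le_mul_sub_of_deriv_le (f := fun _ => (0 : ℝ)) (f' := fun _ => 0)
      (κ := 1) (hT a ha).1 (fun τ _ => hasDerivAt_const τ 0) (fun τ hτ => hd n τ hτ.1)
      (fun τ _ => by positivity)
    rw [h0] at this
    linarith
  have hinactive : ∀ k, 1 < ∑ i, x k i * what i →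
      Tendsto (fun a => R a k (T a)) atTop (𝓝 0) := by
    intro k hk
    obtain ⟨γs, hγs, ρ₀, hρ₀, A, hA⟩ := hstab k hk
    have hmain : ∀ e : ℝ, 0 < e → ∀ᶠ a in atTop, R a k (T a) ≤ e := by
      intro e he
      obtain ⟨δ, hδ, hδe⟩ : ∃ δ : ℝ, 0 < δ ∧ δ * (2 + μ⁻¹) = e * (8 * γ₂ ^ 2) := by
        have : 0 < 2 + μ⁻¹ := by positivity
        exact ⟨e * (8 * γ₂ ^ 2) / (2 + μ⁻¹), by positivity, by field_simp⟩
      have hexp : Tendsto (fun a : ℝ => Real.exp (-((ρ₀ - 1) * (δ * a ^ 2 - Real.log N))))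
          atTop (𝓝 0) := by
        refine Real.tendsto_exp_neg_atTop_nhds_zero.comp ?_
        exact (tendsto_atTop_add_const_right _ (-Real.log N)
          (hsq.const_mul_atTop hδ)).const_mul_atTop (sub_pos.2 hρ₀)
      filter_upwards [eventually_gt_atTop 0, eventually_ge_atTop A,
        hexp.eventually_le_const hδ, hγs.eventually_le_const hδ,
        hℓ.eventually_le_const (lt_add_one μ⁻¹),
        (hsq.const_mul_atTop hδ).eventually_gt_atTop (Real.log N)] with a ha haA he1 hs1 hl1 hN1
      obtain ⟨h0, hd, hwa⟩ := hR a ha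
      have ha2 : 0 < a ^ 2 := by positivity
      rw [div_le_iff₀ ha2] at hs1 hl1
      set W : ℝ → Fin d → ℝ :=
        fun t i => 2 * a ^ 2 * Real.sinh (4 * ∑ n, R a n t * x n i) with hW
      have hWw : ∀ t, 0 ≤ t → W t = w a t := fun t ht => funext fun i => (hwa t ht i).symm
      set L : ℝ → ℝ := fun t => (1 / (N : ℝ)) * ∑ n, Real.exp (-(∑ i, x n i * W t i)) with hL
      have hLL : ∀ t, 0 ≤ t → L t = Lf a t := fun t ht => by rw [hL, hLf, ← hWw t ht]
      have hb := residual_integral_le hN x W a γ₂ ha hγ₂pos v₀ hv₀ hv₀x (R a) L (fun _ => rfl)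
        (fun _ _ => rfl) h0 (fun n t ht => by rw [hWw t ht]; exact hd n t ht) k (T a)
        (δ * a ^ 2) δ (hT a ha).1 (by positivity) hδ.le (by
          intro t ht h1 h2
          rw [hLL t ht] at h1 h2 ⊢
          rw [hLL _ (hT a ha).1, hlogT a ha] at h2
          rw [hWw t ht]
          have hst := hA a haA t ht (hs1.trans h1) h2
          obtain ⟨hLpos, -, hm2, hm3⟩ := hmargin a t
          have hgap : δ * a ^ 2 - Real.log N ≤ γm a t := by linarith
          have hgpos : 0 < γm a t := by linarith
          rw [le_div_iff₀ hgpos] at hst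
          have hle : -(∑ i, x k i * w a t i) ≤
              -((ρ₀ - 1) * (δ * a ^ 2 - Real.log N)) + -γm a t := by
            nlinarith [mul_le_mul_of_nonneg_left hgap (sub_pos.2 hρ₀).le]
          calc (1 / (N : ℝ)) * Real.exp (-(∑ i, x k i * w a t i))
              ≤ (1 / (N : ℝ)) * (Real.exp (-((ρ₀ - 1) * (δ * a ^ 2 - Real.log N))) *
                  Real.exp (-γm a t)) := by
                rw [← Real.exp_add]; gcongr
            _ = Real.exp (-((ρ₀ - 1) * (δ * a ^ 2 - Real.log N))) *
                  ((1 / (N : ℝ)) * Real.exp (-γm a t)) := by ring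
            _ ≤ δ * Lf a t := by gcongr)
      refine hb.trans ?_
      rw [hLL _ (hT a ha).1, hlogT a ha, div_le_iff₀ (by positivity)]
      nlinarith [mul_le_mul_of_nonneg_left hl1 hδ.le]
    refine tendsto_order.2 ⟨fun b hb => ?_, fun b hb => ?_⟩
    · filter_upwards [eventually_gt_atTop 0] with a ha
      exact hb.trans_le (hRnonneg a ha k)
    · filter_upwards [hmain (b / 2) (by positivity)] with a ha
      linarith
  have hdual : ∀ i, Tendsto (fun a => 4 * ∑ n, R a n (T a) * x n i) atTop
      (𝓝 (Real.arsinh (what i / μ / 2))) := by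
    intro i
    have h1 : Tendsto (fun a => Real.arsinh (w a (T a) i / γm a (T a) *
        (γm a (T a) / a ^ 2) / 2)) atTop (𝓝 (Real.arsinh (what i / μ / 2))) := by
      rw [div_eq_mul_inv (what i) μ]
      exact (Real.continuous_arsinh.tendsto _).comp (((hcoord i).mul hγ).div_const 2)
    refine h1.congr' ?_
    filter_upwards [eventually_gt_atTop 0, hγpos] with a ha hg
    rw [← Real.arsinh_sinh (4 * _), (hR a ha).2.2 _ (hT a ha).1 i]
    congr 1
    field_simp
  have hnonneg : 0 ≤ ∑ i, Real.arsinh (what i / μ / 2) * (v i - what i) := by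
    have hlow : Tendsto (fun a => ∑ n, if 1 < ∑ i, x n i * what i then
        4 * R a n (T a) * (∑ i, x n i * v i - ∑ i, x n i * what i) else 0) atTop (𝓝 0) := by
      rw [show 𝓝 (0 : ℝ) = 𝓝 (∑ _n : Fin N, (0 : ℝ)) by simp]
      refine tendsto_finsetSum _ (fun n _ => ?_)
      split_ifs with hn
      · simpa using ((hinactive n hn).const_mul 4).mul_const
          (∑ i, x n i * v i - ∑ i, x n i * what i)
      · exact tendsto_const_nhds
    have hlimit : Tendsto (fun a => ∑ i, (4 * ∑ n, R a n (T a) * x n i) * (v i - what i)) atTop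
        (𝓝 (∑ i, Real.arsinh (what i / μ / 2) * (v i - what i))) :=
      tendsto_finsetSum _ (fun i _ => (hdual i).mul_const (v i - what i))
    refine le_of_tendsto_of_tendsto hlow hlimit ?_
    filter_upwards [eventually_gt_atTop 0] with a ha
    have e : ∑ i, (4 * ∑ n, R a n (T a) * x n i) * (v i - what i) =
        ∑ n, 4 * R a n (T a) * (∑ i, x n i * v i - ∑ i, x n i * what i) := by
      simp only [← Finset.sum_sub_distrib, Finset.mul_sum, Finset.sum_mul]
      rw [Finset.sum_comm]
      exact Finset.sum_congr rfl (fun n _ => Finset.sum_congr rfl (fun i _ => by ring))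
    rw [e]
    refine Finset.sum_le_sum (fun n _ => ?_)
    split_ifs with hn
    · exact le_rfl
    · have := hRnonneg a ha n
      have h1 : 0 ≤ ∑ i, x n i * v i - ∑ i, x n i * what i := by
        linarith [hv n, not_lt.1 hn]
      positivity
  have htangent : ∑ i, Real.arsinh (what i / μ / 2) * (v i / μ - what i / μ) =
      (∑ i, Real.arsinh (what i / μ / 2) * (v i - what i)) / μ := by
    rw [Finset.sum_div]
    exact Finset.sum_congr rfl (fun i _ => by ring)
  have hsum := Finset.sum_le_sum (s := Finset.univ)
    (fun i _ => hypentropy_tangent_le (what i / μ) (v i / μ))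
  rw [Finset.sum_add_distrib, htangent] at hsum
  linarith [div_nonneg hnonneg hμpos.le]
end
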